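/- arXiv:math/0306043 — 2 statements merged into one kernel-verified Lean document; each statement's English description precedes it below -/
import Mathlib

section
/- Let A be a ring with A/J semisimple and J^3 = 0. Then the following are equivalent: (1) A has finite global dimension; (2) Ext_A^n(S, S) = 0 for all simple A-modules S and all sufficiently large n; (3) every simple A-module has either finite projective dimension or finite injective dimension. -/
open CategoryTheory

noncomputable section

instance (A : Type) [Ring A] : HasExt.{1} (ModuleCat.{0} A) := by
  letI := HasDerivedCategory.standard (ModuleCat.{0} A)
  exact hasExt_of_hasDerivedCategory _

/-- The Jacobson radical of the ring `A`, as a two-sided ideal. -/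
def jrad (A : Type) [Ring A] : TwoSidedIdeal A := TwoSidedIdeal.jacobson ⊥

/-- `A/J` is a semisimple ring. -/
def SemisimpleModJ (A : Type) [Ring A] : Prop :=
  IsSemisimpleRing (jrad A).ringCon.Quotient

/-- The Jacobson radical satisfies `J ^ 3 = 0`. -/
def JCubeZero (A : Type) [Ring A] : Prop :=
  ∀ x y z : A, x ∈ jrad A → y ∈ jrad A → z ∈ jrad A → x * y * z = 0

/-- `A` is semiprimary: `A/J` is semisimple and the Jacobson radical `J` is nilpotent. -/
def IsSemiprimary (A : Type) [Ring A] : Prop :=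
  SemisimpleModJ A ∧
    ∃ n : ℕ, ∀ x : Fin n → A, (∀ i, x i ∈ jrad A) → (List.ofFn x).prod = 0

/-- `A/J` as a left `A`-module, an object of `ModuleCat A`. -/
def AmodJ (A : Type) [Ring A] : ModuleCat.{0} A :=
  ModuleCat.of A (A ⧸ (jrad A).asIdeal)

/-- The submodule `J·N`, for `J` the Jacobson radical of `A` and `N` a submodule of `M`. -/
def jSmul (A : Type) [Ring A] {M : Type} [AddCommGroup M] [Module A M]
    (N : Submodule A M) : Submodule A M :=
  Submodule.span A {y | ∃ x ∈ jrad A, ∃ m ∈ N, y = x • m}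

/-- `M` has projective dimension at most `n`, characterized by vanishing of
`Ext^k(M, -)` for `k > n`. -/
def projDimLE (A : Type) [Ring A] (M : ModuleCat.{0} A) (n : ℕ) : Prop :=
  ∀ (N : ModuleCat.{0} A) (k : ℕ), n < k → Subsingleton (Abelian.Ext M N k)

/-- The projective dimension of `M`, valued in `ℕ∞` (infinite if no bound exists). -/
def projDim (A : Type) [Ring A] (M : ModuleCat.{0} A) : ℕ∞ :=
  sInf {e : ℕ∞ | ∃ n : ℕ, e = n ∧ projDimLE A M n}

/-- `N` has injective dimension at most `n`, characterized by vanishing of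
`Ext^k(-, N)` for `k > n`. -/
def injDimLE (A : Type) [Ring A] (N : ModuleCat.{0} A) (n : ℕ) : Prop :=
  ∀ (M : ModuleCat.{0} A) (k : ℕ), n < k → Subsingleton (Abelian.Ext M N k)

/-- The injective dimension of `N`, valued in `ℕ∞`. -/
def injDim (A : Type) [Ring A] (N : ModuleCat.{0} A) : ℕ∞ :=
  sInf {e : ℕ∞ | ∃ n : ℕ, e = n ∧ injDimLE A N n}

/-- The (left) global dimension of `A`: the supremum of projective dimensions of
all left `A`-modules. -/
def globalDim (A : Type) [Ring A] : ℕ∞ :=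
  ⨆ M : ModuleCat.{0} A, projDim A M

/-- `N` is the (first) syzygy of `M`: `N` is isomorphic to the kernel of a
projective cover `P → M` (a surjection from a projective module with superfluous
kernel, i.e. kernel contained in `J·P`). -/
def IsSyzygy (A : Type) [Ring A] (M N : ModuleCat.{0} A) : Prop :=
  ∃ (P : ModuleCat.{0} A) (f : P →ₗ[A] M), Module.Projective A P ∧
    Function.Surjective f ∧ LinearMap.ker f ≤ jSmul A (⊤ : Submodule A P) ∧
    Nonempty (N ≃ₗ[A] LinearMap.ker f)

/-- `N` is the `n`-th syzygy `Ω^n M` of `M` in its minimal projective resolution. -/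
def IsNthSyzygy (A : Type) [Ring A] : ℕ → ModuleCat.{0} A → ModuleCat.{0} A → Prop
  | 0, M, N => Nonempty (M ≃ₗ[A] N)
  | n + 1, M, N => ∃ K : ModuleCat.{0} A, IsNthSyzygy A n M K ∧ IsSyzygy A K N

/-- `S` is (isomorphic to) a direct summand of the module `W`. -/
def IsDirectSummandOf (A : Type) [Ring A] (S W : ModuleCat.{0} A) : Prop :=
  ∃ U V : Submodule A W, IsCompl U V ∧ Nonempty (S ≃ₗ[A] U)

/-- The submodule `X` is a direct summand of the submodule `W` (inside a common
ambient module). -/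
def IsSummandIn (A : Type) [Ring A] {P : Type} [AddCommGroup P] [Module A P]
    (X W : Submodule A P) : Prop :=
  X ≤ W ∧ ∃ C ≤ W, X ⊓ C = ⊥ ∧ X ⊔ C = W

/-- The module `N` (a submodule of an ambient module) has no simple direct summand. -/
def NoSimpleSummand (A : Type) [Ring A] {P : Type} [AddCommGroup P] [Module A P]
    (N : Submodule A P) : Prop :=
  ¬ ∃ S : Submodule A P, IsSimpleModule A S ∧ IsSummandIn A S N

/-- The order relation on simple modules: `S ⪯ T` iff `S` is a direct summand of
some syzygy `Ω^m T`. -/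
def Preceq (A : Type) [Ring A] (S T : ModuleCat.{0} A) : Prop :=
  ∃ (m : ℕ) (W : ModuleCat.{0} A), IsNthSyzygy A m T W ∧ IsDirectSummandOf A S W

/-- `Ext_A^n(S, S) = 0` for every simple `A`-module `S` and every `n ≥ m`. -/
def ExtSelfVanishes (A : Type) [Ring A] (m : ℕ) : Prop :=
  ∀ S : ModuleCat.{0} A, IsSimpleModule A S →
    ∀ n : ℕ, m ≤ n → Subsingleton (Abelian.Ext S S n)

/-- The Yoneda ring `E = ⊕ₙ Ext^n(A/J, A/J)` is generated in finite degrees: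
there is `s` such that every homogeneous element of degree `n > s` is a sum of
Yoneda products of homogeneous elements of positive degrees `< n`. -/
def YonedaGeneratedInFiniteDegrees (A : Type) [Ring A] : Prop :=
  ∃ s : ℕ, ∀ n : ℕ, s < n → ∀ e : Abelian.Ext (AmodJ A) (AmodJ A) n,
    e ∈ AddSubgroup.closure {x : Abelian.Ext (AmodJ A) (AmodJ A) n |
      ∃ (i j : ℕ) (h : i + j = n) (_ : 0 < i) (_ : 0 < j)
        (a : Abelian.Ext (AmodJ A) (AmodJ A) i)
        (b : Abelian.Ext (AmodJ A) (AmodJ A) j), x = a.comp b h}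

/-- The data of the canonical sequence `(M₀ = S, M₁, M₂, ...)` associated to a
simple module `S` over a ring with `J³ = 0`: for each `n`, `P n` is a projective
cover of `M n`, and its kernel (the syzygy `Ω M_n`) decomposes as
`M_{n+1} ⊕ Y_{n+1}`, where `Y_{n+1}` is a direct summand of `J²·P n` and
`M_{n+1} ∩ J²·P n = J·M_{n+1}`. -/
structure AssocSeqData (A : Type) [Ring A] (S : ModuleCat.{0} A) where
  M : ℕ → ModuleCat.{0} A
  iso0 : Nonempty (M 0 ≃ₗ[A] S)
  P : ℕ → ModuleCat.{0} A
  proj : ∀ n, Module.Projective A (P n)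
  π : ∀ n, P n →ₗ[A] M n
  surj : ∀ n, Function.Surjective (π n)
  cover : ∀ n, LinearMap.ker (π n) ≤ jSmul A (⊤ : Submodule A (P n))
  Msub : ∀ n, Submodule A (P n)
  Ysub : ∀ n, Submodule A (P n)
  isoM : ∀ n, Nonempty (M (n + 1) ≃ₗ[A] Msub n)
  indep : ∀ n, Msub n ⊓ Ysub n = ⊥
  sup_eq : ∀ n, Msub n ⊔ Ysub n = LinearMap.ker (π n)
  Y_summand : ∀ n, IsSummandIn A (Ysub n) (jSmul A (jSmul A (⊤ : Submodule A (P n))))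
  M_cap : ∀ n, Msub n ⊓ jSmul A (jSmul A (⊤ : Submodule A (P n))) = jSmul A (Msub n)

/-- The iterated Yoneda product `eₙ · ... · e₂ · e₁ · 1` of classes
`eᵢ ∈ Ext^1(S_{i-1}, S_i)`. -/
def extChain (A : Type) [Ring A] (S : ℕ → ModuleCat.{0} A)
    (e : ∀ i : ℕ, Abelian.Ext (S i) (S (i + 1)) 1) :
    ∀ n : ℕ, Abelian.Ext (S 0) (S n) n
  | 0 => Abelian.Ext.mk₀ (𝟙 (S 0))
  | n + 1 => (extChain A S e n).comp (e n) rfl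

/-- The iterated Yoneda product `eₙ · ... · e₁ · f` where `f ∈ Ext^0(S, A/J)` and
`eᵢ ∈ Ext^1(A/J, A/J)`. -/
def extChainFrom (A : Type) [Ring A] {S : ModuleCat.{0} A}
    (f : Abelian.Ext S (AmodJ A) 0)
    (e : ℕ → Abelian.Ext (AmodJ A) (AmodJ A) 1) :
    ∀ n : ℕ, Abelian.Ext S (AmodJ A) n
  | 0 => f
  | n + 1 => (extChainFrom A f e n).comp (e n) rfl

section NilpotentIdeal

variable {A : Type*} [Ring A] {J : Ideal A}

/-- If `A ⧸ J` is semisimple then every module annihilated by `J` is semisimple. -/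
theorem isSemisimpleModule_of_forall_smul_eq_zero [IsSemisimpleModule A (A ⧸ J)]
    {M : Type*} [AddCommGroup M] [Module A M] (h : ∀ a ∈ J, ∀ m : M, a • m = 0) :
    IsSemisimpleModule A M := by
  refine IsSemisimpleModule.of_surjective (M := M →₀ (A ⧸ J))
    (Finsupp.lsum ℕ fun m => Submodule.liftQ J (LinearMap.toSpanSingleton A M m)
      fun a ha => by simpa using h a ha m) fun m => ?_
  exact ⟨Finsupp.single m (Submodule.Quotient.mk 1), by simp⟩

/-- A module modulo its product with `J` is annihilated by `J`. -/
theorem smul_quotient_smul_top_eq_zero {M : Type*} [AddCommGroup M] [Module A M] (a : A)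
    (ha : a ∈ J) (x : M ⧸ (J • ⊤ : Submodule A M)) : a • x = 0 := by
  obtain ⟨m, rfl⟩ := Submodule.Quotient.mk_surjective _ x
  rw [← Submodule.Quotient.mk_smul, Submodule.Quotient.mk_eq_zero]
  exact Submodule.smul_mem_smul ha trivial

/-- A linear map to a module annihilated by `J` vanishes on the product with `J`. -/
theorem smul_top_le_ker {M N : Type*} [AddCommGroup M] [Module A M] [AddCommGroup N] [Module A N]
    (h : ∀ a ∈ J, ∀ m : N, a • m = 0) (f : M →ₗ[A] N) :
    (J • ⊤ : Submodule A M) ≤ LinearMap.ker f :=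
  Submodule.smul_le.2 fun a ha m _ => by simp [h a ha]

theorem map_mem_smul {M N : Type*} [AddCommGroup M] [Module A M] [AddCommGroup N] [Module A N]
    {f : M →ₗ[A] N} {L : Submodule A M} {L' : Submodule A N} (hf : ∀ x ∈ L, f x ∈ L') {x : M}
    (hx : x ∈ J • L) : f x ∈ J • L' := by
  have : (J • L).map f ≤ J • L' := by
    rw [Submodule.map_smul'']
    exact smul_mono_right _ (Submodule.map_le_iff_le_comap.2 hf)
  exact this ⟨x, hx, rfl⟩

theorem map_mem_smul_top {M N : Type*} [AddCommGroup M] [Module A M] [AddCommGroup N] [Module A N]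
    (f : M →ₗ[A] N) {x : M} (hx : x ∈ (J • ⊤ : Submodule A M)) :
    f x ∈ (J • ⊤ : Submodule A N) :=
  map_mem_smul (fun _ _ => Submodule.mem_top) hx

theorem smul_eq_zero_of_mem_smul_smul (h3 : ∀ x ∈ J, ∀ y ∈ J, ∀ z ∈ J, x * y * z = 0)
    {M : Type*} [AddCommGroup M] [Module A M] {N : Submodule A M} {a : A} (ha : a ∈ J) {x : M}
    (hx : x ∈ J • J • N) : a • x = 0 := by
  refine Submodule.smul_induction_on hx (fun b hb y hy => ?_)
    fun x y hx hy => by rw [smul_add, hx, hy, add_zero]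
  refine Submodule.smul_induction_on hy (fun c hc z _ => ?_)
    fun x y hx hy => by rw [smul_add, smul_add, hx, hy, add_zero]
  rw [← mul_smul, ← mul_smul, h3 a ha b hb c hc, zero_smul]

theorem smul_smul_smul_eq_bot (h3 : ∀ x ∈ J, ∀ y ∈ J, ∀ z ∈ J, x * y * z = 0)
    {M : Type*} [AddCommGroup M] [Module A M] (N : Submodule A M) : J • J • J • N = ⊥ :=
  eq_bot_iff.2 <| Submodule.smul_le.2 fun _ ha _ hx => smul_eq_zero_of_mem_smul_smul h3 ha hx

/-- Nakayama's lemma for a nilpotent ideal. -/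
theorem eq_top_of_sup_smul_eq_top (h3 : ∀ x ∈ J, ∀ y ∈ J, ∀ z ∈ J, x * y * z = 0)
    {M : Type*} [AddCommGroup M] [Module A M] {N : Submodule A M} (h : N ⊔ J • ⊤ = ⊤) :
    N = ⊤ := by
  have key : ∀ L : Submodule A M, N ⊔ L = ⊤ → N ⊔ J • L = ⊤ := fun L hL => by
    rw [eq_top_iff, ← h, sup_le_iff]
    refine ⟨le_sup_left, ?_⟩
    rw [← hL, Submodule.smul_sup]
    exact sup_le_sup_right Submodule.smul_le_right _
  have := key _ (key _ h)
  rwa [smul_smul_smul_eq_bot h3, sup_bot_eq] at this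

theorem smul_eq_zero_of_isSimpleModule (h3 : ∀ x ∈ J, ∀ y ∈ J, ∀ z ∈ J, x * y * z = 0)
    {S : Type*} [AddCommGroup S] [Module A S] [IsSimpleModule A S] (a : A) (ha : a ∈ J) (s : S) :
    a • s = 0 := by
  have : Nontrivial S := IsSimpleModule.nontrivial A S
  have hbot : (J • ⊤ : Submodule A S) = ⊥ := by
    refine (eq_bot_or_eq_top _).resolve_right fun h => ?_
    refine bot_ne_top (α := Submodule A S) (eq_top_of_sup_smul_eq_top h3 ?_)
    rw [h, sup_top_eq]
  simpa [hbot] using Submodule.smul_mem_smul ha (Submodule.mem_top (x := s))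

theorem nontrivial_quotient_smul_top (h3 : ∀ x ∈ J, ∀ y ∈ J, ∀ z ∈ J, x * y * z = 0)
    (M : Type*) [AddCommGroup M] [Module A M] [Nontrivial M] :
    Nontrivial (M ⧸ (J • ⊤ : Submodule A M)) := by
  refine Submodule.Quotient.nontrivial_iff.2 fun h => ?_
  refine bot_ne_top (α := Submodule A M) (eq_top_of_sup_smul_eq_top h3 ?_)
  rw [h, sup_top_eq]

theorem pow_three_eq_zero (h3 : ∀ x ∈ J, ∀ y ∈ J, ∀ z ∈ J, x * y * z = 0)
    {M : Type*} [AddCommGroup M] [Module A M] (φ : Module.End A M)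
    (hφ : ∀ x, φ x ∈ (J • ⊤ : Submodule A M)) : φ ^ 3 = 0 := by
  refine LinearMap.ext fun x => ?_
  have h1 : ∀ y ∈ (J • ⊤ : Submodule A M), φ y ∈ (J • J • ⊤ : Submodule A M) := fun y hy =>
    map_mem_smul (fun y _ => hφ y) hy
  have h2 : φ (φ (φ x)) ∈ (J • J • J • ⊤ : Submodule A M) :=
    map_mem_smul (fun y hy => map_mem_smul (fun y _ => hφ y) hy) (h1 _ (hφ x))
  rw [smul_smul_smul_eq_bot h3] at h2
  exact h2

/-- The ring homomorphism `End M → End (M / JM)`. -/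
def quotientEnd (J : Ideal A) (M : Type*) [AddCommGroup M] [Module A M] :
    Module.End A M →+* Module.End A (M ⧸ (J • ⊤ : Submodule A M)) where
  toFun φ := Submodule.mapQ _ _ φ fun _ hx => map_mem_smul_top φ hx
  map_one' := by ext; rfl
  map_mul' _ _ := by ext; rfl
  map_zero' := by ext; rfl
  map_add' _ _ := by ext; rfl

theorem quotientEnd_mk {M : Type*} [AddCommGroup M] [Module A M] (φ : Module.End A M) (x : M) :
    quotientEnd J M φ (Submodule.Quotient.mk x) = Submodule.Quotient.mk (φ x) :=
  rfl

theorem isNilpotent_of_mem_ker_quotientEnd (h3 : ∀ x ∈ J, ∀ y ∈ J, ∀ z ∈ J, x * y * z = 0)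
    {M : Type*} [AddCommGroup M] [Module A M] (φ : Module.End A M)
    (hφ : φ ∈ RingHom.ker (quotientEnd J M)) : IsNilpotent φ := by
  refine ⟨3, pow_three_eq_zero h3 φ fun x => ?_⟩
  rw [← Submodule.Quotient.mk_eq_zero, ← quotientEnd_mk, RingHom.mem_ker.1 hφ,
    LinearMap.zero_apply]

/-- An idempotent endomorphism of `F / JF` lifts to an idempotent endomorphism of the projective
module `F`. -/
theorem exists_isIdempotentElem_quotientEnd_eq (h3 : ∀ x ∈ J, ∀ y ∈ J, ∀ z ∈ J, x * y * z = 0)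
    {F : Type*} [AddCommGroup F] [Module A F] [Module.Projective A F]
    (e : Module.End A (F ⧸ (J • ⊤ : Submodule A F))) (he : IsIdempotentElem e) :
    ∃ ε : Module.End A F, IsIdempotentElem ε ∧ quotientEnd J F ε = e := by
  obtain ⟨φ, hφ⟩ := Module.projective_lifting_property (Submodule.mkQ (J • ⊤ : Submodule A F))
    (e ∘ₗ Submodule.mkQ _) (Submodule.mkQ_surjective _)
  have hρ : quotientEnd J F φ = e := LinearMap.ext fun y => by
    obtain ⟨x, rfl⟩ := Submodule.Quotient.mk_surjective _ y
    exact LinearMap.congr_fun hφ x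
  exact exists_isIdempotentElem_eq_of_ker_isNilpotent (quotientEnd J F)
    (isNilpotent_of_mem_ker_quotientEnd h3) e ⟨φ, hρ⟩ he

/-- If `A ⧸ J` is semisimple and `J ^ 3 = 0`, every module is the quotient of a projective
module `P` by a submodule of `JP`. -/
theorem exists_projective_ker_le_smul_top [IsSemisimpleModule A (A ⧸ J)]
    (h3 : ∀ x ∈ J, ∀ y ∈ J, ∀ z ∈ J, x * y * z = 0) (M : Type*) [AddCommGroup M] [Module A M] :
    ∃ (P : Submodule A (M →₀ A)) (π : P →ₗ[A] M),
      Module.Projective A P ∧ Function.Surjective π ∧ LinearMap.ker π ≤ J • ⊤ := by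
  let F := M →₀ A
  let f : F →ₗ[A] M := Finsupp.linearCombination A id
  have hf : Function.Surjective f := Finsupp.linearCombination_id_surjective A M
  let g : F ⧸ (J • ⊤ : Submodule A F) →ₗ[A] M ⧸ (J • ⊤ : Submodule A M) :=
    Submodule.mapQ _ _ f fun x hx => map_mem_smul_top f hx
  have hgf : ∀ x, g (Submodule.Quotient.mk x) = Submodule.Quotient.mk (f x) := fun _ => rfl
  have hg : Function.Surjective g := fun y => by
    obtain ⟨m, rfl⟩ := Submodule.Quotient.mk_surjective _ y
    obtain ⟨x, rfl⟩ := hf m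
    exact ⟨Submodule.Quotient.mk x, rfl⟩
  have : IsSemisimpleModule A (F ⧸ (J • ⊤ : Submodule A F)) :=
    isSemisimpleModule_of_forall_smul_eq_zero (J := J) smul_quotient_smul_top_eq_zero
  obtain ⟨s, hs⟩ := IsSemisimpleModule.lifting_property g hg LinearMap.id
  have hs' : ∀ y, g (s y) = y := fun y => LinearMap.congr_fun hs y
  obtain ⟨ε, hε, hερ⟩ := exists_isIdempotentElem_quotientEnd_eq h3 (s ∘ₗ g)
    (LinearMap.ext fun x => congrArg s (hs' (g x)))
  have hεε : ∀ x, ε (ε x) = ε x := fun x => LinearMap.congr_fun hε x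
  have hmk : ∀ x, Submodule.Quotient.mk (ε x) = s (g (Submodule.Quotient.mk x)) := fun x => by
    rw [← quotientEnd_mk, hερ]; rfl
  have hgf : ∀ x, g (Submodule.Quotient.mk x) = Submodule.Quotient.mk (f x) := fun _ => rfl
  refine ⟨LinearMap.range ε, f ∘ₗ Submodule.subtype _, ?_, ?_, ?_⟩
  · refine Module.Projective.of_split (Submodule.subtype _) ε.rangeRestrict ?_
    refine LinearMap.ext fun ⟨_, x, hx⟩ => Subtype.ext ?_
    subst hx
    exact hεε x
  · rw [← LinearMap.range_eq_top]
    refine eq_top_of_sup_smul_eq_top h3 (eq_top_iff.2 fun m _ => ?_)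
    obtain ⟨x, rfl⟩ := hf m
    rw [← add_sub_cancel (f (ε x)) (f x)]
    refine Submodule.add_mem_sup ⟨⟨ε x, x, rfl⟩, rfl⟩ ?_
    rw [← Submodule.Quotient.mk_eq_zero, Submodule.Quotient.mk_sub, ← hgf, ← hgf, hmk, hs',
      sub_self]
  · rintro ⟨y, x, rfl⟩ hy
    have hy : f (ε x) = 0 := hy
    have h1 : ε x ∈ (J • ⊤ : Submodule A F) := by
      rw [← Submodule.Quotient.mk_eq_zero, hmk, ← hs' (g _), ← hmk, hgf, hy,
        Submodule.Quotient.mk_zero, map_zero]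
    have h2 := map_mem_smul_top (N := LinearMap.range ε) ε.rangeRestrict h1
    convert h2 using 1
    exact Subtype.ext (hεε x).symm

/-- If `K ≤ JP` and `J ^ 3 = 0`, then `K` splits as the direct sum of a semisimple module and a
module `M'` such that the projection `K → M' / JM'` extends to `JP`. -/
theorem exists_decomposition_extension [IsSemisimpleModule A (A ⧸ J)]
    (h3 : ∀ x ∈ J, ∀ y ∈ J, ∀ z ∈ J, x * y * z = 0) {P : Type*} [AddCommGroup P] [Module A P]
    {K : Submodule A P} (hK : K ≤ J • ⊤) :
    ∃ (Y : Submodule A K) (r : K →ₗ[A] Y) (p : K →ₗ[A] LinearMap.ker r)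
      (g : (J • ⊤ : Submodule A P) →ₗ[A]
        LinearMap.ker r ⧸ (J • ⊤ : Submodule A (LinearMap.ker r))),
      IsSemisimpleModule A Y ∧ (∀ y : Y, r y = y) ∧ (∀ x : LinearMap.ker r, p x = x) ∧
        ∀ x : K, g (Submodule.inclusion hK x) = Submodule.Quotient.mk (p x) := by
  let X : Submodule A P := J • ⊤
  let f : K →ₗ[A] X ⧸ (J • ⊤ : Submodule A X) := Submodule.mkQ _ ∘ₗ Submodule.inclusion hK
  let L : Submodule A K := LinearMap.ker f
  have hL : ∀ a ∈ J, ∀ x ∈ L, a • x = 0 := fun a ha x hx => by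
    have hx : Submodule.inclusion hK x ∈ (J • ⊤ : Submodule A X) :=
      (Submodule.Quotient.mk_eq_zero _).1 hx
    have hx' : (x : P) ∈ (J • J • ⊤ : Submodule A P) :=
      map_mem_smul (f := X.subtype) (L := ⊤) (L' := X) (fun y _ => y.2) hx
    exact Subtype.ext (smul_eq_zero_of_mem_smul_smul h3 ha hx')
  have hJL : (J • ⊤ : Submodule A K) ≤ L := smul_top_le_ker smul_quotient_smul_top_eq_zero f
  have : IsSemisimpleModule A L :=
    isSemisimpleModule_of_forall_smul_eq_zero (J := J) fun a ha x => Subtype.ext (hL a ha x x.2)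
  obtain ⟨C, hC⟩ := exists_isCompl ((J • ⊤ : Submodule A K).comap L.subtype)
  let Y : Submodule A K := C.map L.subtype
  have hYL : Y ≤ L := Submodule.map_subtype_le _ _
  have hYJ : ∀ y ∈ Y, y ∈ (J • ⊤ : Submodule A K) → y = 0 := by
    rintro _ ⟨y, hy, rfl⟩ hyJ
    have := Submodule.disjoint_def.1 hC.disjoint y hyJ hy
    rw [this, map_zero]
  have hdec : ∀ x ∈ L, ∃ y ∈ Y, ∃ z ∈ (J • ⊤ : Submodule A K), z + y = x := fun x hx => by
    obtain ⟨z, hz, y, hy, h⟩ := Submodule.mem_sup.1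
      (hC.codisjoint.eq_top.symm ▸ Submodule.mem_top : (⟨x, hx⟩ : L) ∈ _ ⊔ C)
    exact ⟨y, ⟨y, hy, rfl⟩, z, hz, congrArg Subtype.val h⟩
  have hYss : IsSemisimpleModule A Y :=
    isSemisimpleModule_of_forall_smul_eq_zero (J := J) fun a ha x =>
      Subtype.ext (hL a ha x (hYL x.2))
  have : IsSemisimpleModule A (K ⧸ (J • ⊤ : Submodule A K)) :=
    isSemisimpleModule_of_forall_smul_eq_zero (J := J) smul_quotient_smul_top_eq_zero
  obtain ⟨r', hr'⟩ := IsSemisimpleModule.extension_property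
    (Submodule.mkQ (J • ⊤ : Submodule A K) ∘ₗ Y.subtype)
    ((injective_iff_map_eq_zero _).2 fun y hy =>
      Subtype.ext (hYJ y y.2 ((Submodule.Quotient.mk_eq_zero _).1 hy))) LinearMap.id
  let r : K →ₗ[A] Y := r' ∘ₗ Submodule.mkQ _
  have hr : ∀ y : Y, r y = y := fun y => LinearMap.congr_fun hr' y
  let p : K →ₗ[A] LinearMap.ker r :=
    LinearMap.codRestrict _ (LinearMap.id - Y.subtype ∘ₗ r) fun x => by simp [hr]
  have hpL : ∀ x ∈ L, p x ∈ (J • ⊤ : Submodule A (LinearMap.ker r)) := fun x hx => by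
    obtain ⟨y, hy, z, hz, rfl⟩ := hdec x hx
    have : p y = 0 := Subtype.ext (by
      change y - (r y : K) = 0
      rw [hr ⟨y, hy⟩, sub_self])
    rw [map_add, this, add_zero]
    exact map_mem_smul_top p hz
  have : IsSemisimpleModule A (X ⧸ (J • ⊤ : Submodule A X)) :=
    isSemisimpleModule_of_forall_smul_eq_zero (J := J) smul_quotient_smul_top_eq_zero
  obtain ⟨g', hg'⟩ := IsSemisimpleModule.extension_property (L.liftQ f le_rfl)
    (LinearMap.ker_eq_bot.1 (Submodule.ker_liftQ_eq_bot _ _ _ le_rfl))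
    (L.liftQ (Submodule.mkQ (J • ⊤ : Submodule A (LinearMap.ker r)) ∘ₗ p)
      fun x hx => (Submodule.Quotient.mk_eq_zero _).2 (hpL x hx))
  refine ⟨Y, r, p, g' ∘ₗ Submodule.mkQ _, hYss, hr, fun x => Subtype.ext ?_, fun x =>
    LinearMap.congr_fun hg' (Submodule.Quotient.mk x)⟩
  change (x : K) - (r x : K) = x
  rw [LinearMap.mem_ker.1 x.2, Submodule.coe_zero, sub_zero]

end NilpotentIdeal

section YonedaProducts

open Abelian

variable {C : Type*} [Category C] [Abelian C] [HasExt C]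

/-- Left Yoneda multiplication by `ω` is injective on extensions of positive degree. -/
def CancelsLeft {M N : C} {n : ℕ} (ω : Ext M N n) : Prop :=
  ∀ ⦃k m : ℕ⦄ (h : n + k = m), 1 ≤ k → ∀ ⦃X : C⦄ (z : Ext N X k), ω.comp z h = 0 → z = 0

theorem CancelsLeft.comp {M N K : C} {a b c : ℕ} {ω : Ext M N a} {υ : Ext N K b}
    (hω : CancelsLeft ω) (hυ : CancelsLeft υ) (h : a + b = c) : CancelsLeft (ω.comp υ h) := by
  intro k m hk h1 X z hz
  refine hυ rfl h1 z (hω (m := m) (by omega) (by omega) _ ?_)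
  rwa [← Ext.comp_assoc ω υ z h rfl (by omega)]

theorem cancelsLeft_mk₀_of_section {M N : C} {p : M ⟶ N} {s : N ⟶ M} (h : s ≫ p = 𝟙 N) :
    CancelsLeft (Ext.mk₀ p) := by
  intro k m hk _ X z hz
  obtain rfl : k = m := by omega
  rw [← Ext.mk₀_id_comp z, ← h, ← Ext.mk₀_comp_mk₀_assoc, hz, Ext.comp_zero]

theorem cancelsLeft_extClass {S : ShortComplex C} (hS : S.ShortExact) [Projective S.X₂] :
    CancelsLeft hS.extClass := by
  intro k m hk h1 X z hz
  obtain ⟨x, rfl⟩ := Ext.contravariant_sequence_exact₁ hS X z hk hz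
  obtain ⟨k, rfl⟩ : ∃ l, k = l + 1 := ⟨k - 1, by omega⟩
  rw [Ext.eq_zero_of_projective x, Ext.comp_zero]

end YonedaProducts

section Syzygy

open Abelian

variable {A : Type} [Ring A] {J : Ideal A}

/-- The quotient `M / JM`. -/
def head (J : Ideal A) (M : ModuleCat.{0} A) : ModuleCat.{0} A :=
  ModuleCat.of A (M ⧸ (J • ⊤ : Submodule A M))

/-- The projection `M ⟶ M / JM`. -/
def toHead (J : Ideal A) (M : ModuleCat.{0} A) : M ⟶ head J M :=
  ModuleCat.ofHom (Submodule.mkQ _)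

theorem exists_syzygy_step [IsSemisimpleModule A (A ⧸ J)]
    (h3 : ∀ x ∈ J, ∀ y ∈ J, ∀ z ∈ J, x * y * z = 0) (M : ModuleCat.{0} A) :
    ∃ (M' Y : ModuleCat.{0} A) (ω : Ext M M' 1) (υ : Ext M Y 1) (η : Ext (head J M) (head J M') 1),
      IsSemisimpleModule A Y ∧ CancelsLeft ω ∧ CancelsLeft υ ∧
      ω.comp (Ext.mk₀ (toHead J M')) (add_zero 1) =
        (Ext.mk₀ (toHead J M)).comp η (zero_add 1) ∧
      (Nontrivial M' → ω.comp (Ext.mk₀ (toHead J M')) (add_zero 1) ≠ 0) ∧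
      ∀ n, HasProjectiveDimensionLT M' n → HasProjectiveDimensionLT Y n →
        HasProjectiveDimensionLT M (n + 1) := by
  obtain ⟨P, π, hP, hπ, hker⟩ : ∃ (P : ModuleCat.{0} A) (π : P →ₗ[A] M),
      Module.Projective A P ∧ Function.Surjective π ∧ LinearMap.ker π ≤ J • ⊤ :=
    have ⟨P, π, h⟩ := exists_projective_ker_le_smul_top h3 M
    ⟨ModuleCat.of A P, π, h⟩
  obtain ⟨Y, r, p, g, hY, hr, hp, hg⟩ := exists_decomposition_extension h3 hker
  let ρ : P →ₗ[A] M ⧸ (J • ⊤ : Submodule A M) := Submodule.mkQ _ ∘ₗ π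
  have hρ : Function.Surjective ρ := (Submodule.mkQ_surjective _).comp hπ
  have hπρ : LinearMap.ker π ≤ LinearMap.ker ρ := LinearMap.ker_le_ker_comp _ _
  have hρJ : LinearMap.ker ρ ≤ J • ⊤ := fun x hx => by
    have hx : π x ∈ (J • ⊤ : Submodule A M) := (Submodule.Quotient.mk_eq_zero _).1 hx
    rw [← LinearMap.range_eq_top.2 hπ, LinearMap.range_eq_map, ← Submodule.map_smul''] at hx
    obtain ⟨y, hy, hyx⟩ := hx
    rw [← sub_add_cancel x y]
    exact add_mem (hker (by simp [hyx])) hy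
  have e1 := LinearMap.shortExact_shortComplexKer hπ
  have e2 := LinearMap.shortExact_shortComplexKer hρ
  have e3 := LinearMap.shortExact_shortComplexKer (f := r) fun y => ⟨y, hr y⟩
  have hPC : Projective (ModuleCat.of A P) := (IsProjective.iff_projective P).1 hP
  let f : π.shortComplexKer ⟶ ρ.shortComplexKer :=
    { τ₁ := ModuleCat.ofHom (Submodule.inclusion hπρ)
      τ₂ := 𝟙 _
      τ₃ := toHead J M }
  have hnat := e1.extClass_naturality e2 f
  let M' := ModuleCat.of A (LinearMap.ker r)
  let p' : π.shortComplexKer.X₁ ⟶ M' := ModuleCat.ofHom p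
  let r' : π.shortComplexKer.X₁ ⟶ ModuleCat.of A Y := ModuleCat.ofHom r
  let g' : ρ.shortComplexKer.X₁ ⟶ head J M' := ModuleCat.ofHom (g ∘ₗ Submodule.inclusion hρJ)
  have hfg : f.τ₁ ≫ g' = p' ≫ toHead J M' := by
    ext x
    exact hg x
  have : Projective π.shortComplexKer.X₂ := hPC
  have hgood := cancelsLeft_extClass e1
  refine ⟨M', ModuleCat.of A Y, e1.extClass.comp (Ext.mk₀ p') (add_zero 1),
    e1.extClass.comp (Ext.mk₀ r') (add_zero 1), e2.extClass.comp (Ext.mk₀ g') (add_zero 1), hY,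
    hgood.comp (cancelsLeft_mk₀_of_section (s := ModuleCat.ofHom (Submodule.subtype _)) ?_) _,
    hgood.comp (cancelsLeft_mk₀_of_section (s := ModuleCat.ofHom (Submodule.subtype _)) ?_) _,
    ?_, fun hM' h0 => ?_, fun n hn hn' => ?_⟩
  · exact ModuleCat.hom_ext (LinearMap.ext hp)
  · exact ModuleCat.hom_ext (LinearMap.ext hr)
  · rw [Ext.comp_assoc_of_second_deg_zero, Ext.mk₀_comp_mk₀, ← hfg, ← Ext.mk₀_comp_mk₀,
      ← Ext.comp_assoc_of_second_deg_zero, hnat, Ext.comp_assoc_of_third_deg_zero]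
    rfl
  · rw [Ext.comp_assoc_of_second_deg_zero, Ext.mk₀_comp_mk₀] at h0
    obtain ⟨x, hx⟩ := Ext.contravariant_sequence_exact₁ e1 _ _ rfl h0
    obtain ⟨φ, rfl⟩ := (Ext.mk₀_bijective _ _).2 x
    rw [Ext.mk₀_comp_mk₀] at hx
    have hx := (Ext.mk₀_bijective _ _).1 hx
    have := nontrivial_quotient_smul_top h3 M'
    obtain ⟨y, hy⟩ := exists_ne (0 : M' ⧸ (J • ⊤ : Submodule A M'))
    obtain ⟨x, rfl⟩ := Submodule.Quotient.mk_surjective _ y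
    refine hy ?_
    rw [← hp x]
    refine (LinearMap.congr_fun (ModuleCat.hom_ext_iff.1 hx) (x : LinearMap.ker π)).symm.trans ?_
    exact smul_top_le_ker smul_quotient_smul_top_eq_zero φ.hom (hker (x : LinearMap.ker π).2)
  · have h2 : HasProjectiveDimensionLT π.shortComplexKer.X₁ n :=
      e3.hasProjectiveDimensionLT_X₂ n hn hn'
    have := hasProjectiveDimensionLT_of_ge π.shortComplexKer.X₂ 1 (n + 1) (by omega)
    exact e1.hasProjectiveDimensionLT_X₃ n h2 this

end Syzygy

section ExtChain

open Abelian

variable {A : Type} [Ring A] {V : ℕ → ModuleCat.{0} A}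

theorem extChain_add (e : ∀ i : ℕ, Ext (V i) (V (i + 1)) 1) (a n : ℕ) :
    extChain A V e (a + n) = (extChain A V e a).comp
      (extChain A (fun i => V (a + i)) (fun i => e (a + i)) n) rfl := by
  induction n with
  | zero => exact (Ext.comp_mk₀_id _).symm
  | succ n ih =>
    change (extChain A V e (a + n)).comp (e (a + n)) rfl = _
    rw [ih]
    exact Ext.comp_assoc _ _ _ rfl rfl rfl

theorem extChain_eq_zero_of_le {e : ∀ i : ℕ, Ext (V i) (V (i + 1)) 1} {a n : ℕ}
    (h : extChain A V e a = 0) (han : a ≤ n) : extChain A V e n = 0 := by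
  obtain ⟨k, rfl⟩ := Nat.exists_eq_add_of_le han
  rw [extChain_add, h, Ext.zero_comp]

theorem extChain_congr {e e' : ∀ i : ℕ, Ext (V i) (V (i + 1)) 1} {n : ℕ}
    (h : ∀ i < n, e i = e' i) : extChain A V e n = extChain A V e' n := by
  induction n with
  | zero => rfl
  | succ n ih =>
    change (extChain A V e n).comp (e n) rfl = (extChain A V e' n).comp (e' n) rfl
    rw [ih fun i hi => h i (by omega), h n (by omega)]

variable {N : ℕ} (ε : ∀ n, Fin N → (V n ⟶ V n))

/-- If a chain of extensions is nonzero, it is still nonzero after composing each factor with a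
suitable member of a finite family of endomorphisms summing to the identity. -/
theorem exists_extChain_comp_ne_zero (hε : ∀ n, ∑ j, ε n j = 𝟙 (V n))
    (e : ∀ i : ℕ, Ext (V i) (V (i + 1)) 1) (n : ℕ) {W : ModuleCat.{0} A} {k m : ℕ}
    (z : Ext (V n) W k) (h : n + k = m) (hz : (extChain A V e n).comp z h ≠ 0) :
    ∃ j : ℕ → Fin N, (extChain A V
      (fun i => (e i).comp (Ext.mk₀ (ε (i + 1) (j i))) (add_zero 1)) n).comp z h ≠ 0 := by
  induction n generalizing k with
  | zero =>
    cases N with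
    | zero =>
      have h0 : (0 : V 0 ⟶ V 0) = 𝟙 _ := by simpa using hε 0
      refine absurd ?_ hz
      change (Ext.mk₀ (𝟙 (V 0))).comp z h = 0
      rw [← h0, Ext.mk₀_zero, Ext.zero_comp]
    | succ N => exact ⟨fun _ => 0, hz⟩
  | succ n ih =>
    have hk : 1 + k = k + 1 := add_comm _ _
    have h' : n + (k + 1) = m := by omega
    have h1 : (extChain A V e (n + 1)).comp z h =
        ∑ j, (extChain A V e n).comp
          (((e n).comp (Ext.mk₀ (ε (n + 1) j)) (add_zero 1)).comp z hk) h' := by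
      rw [← Ext.comp_sum, ← Ext.sum_comp, ← Ext.comp_sum, ← Ext.mk₀_sum, hε, Ext.comp_mk₀_id]
      exact Ext.comp_assoc _ _ _ rfl hk (by omega)
    rw [h1] at hz
    obtain ⟨j₀, -, hj₀⟩ := Finset.exists_ne_zero_of_sum_ne_zero hz
    obtain ⟨j, hj⟩ := ih _ h' hj₀
    refine ⟨Function.update j n j₀, ?_⟩
    convert hj using 1
    refine (Ext.comp_assoc _ _ _ rfl hk (by omega)).trans ?_
    beta_reduce
    rw [Function.update_self, extChain_congr fun i hi => ?_]
    rw [Function.update_of_ne (by omega)]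

/-- Long chains of extensions vanish when there are finitely many types `j` of summands and
long extensions between summands of the same type vanish. -/
theorem exists_extChain_eq_zero (hε : ∀ n, ∑ j, ε n j = 𝟙 (V n)) {m : ℕ} (hm : 1 ≤ m)
    (hvan : ∀ (j : Fin N) (a b q : ℕ), m ≤ q → ∀ y : Ext (V a) (V b) q,
      (Ext.mk₀ (ε a j)).comp (y.comp (Ext.mk₀ (ε b j)) (add_zero q)) (zero_add q) = 0)
    (e : ∀ i : ℕ, Ext (V i) (V (i + 1)) 1) : ∃ n, 1 ≤ n ∧ extChain A V e n = 0 := by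
  refine ⟨m * N + 1, by omega, ?_⟩
  by_contra hne
  obtain ⟨j, hj⟩ := exists_extChain_comp_ne_zero ε hε e (m * N + 1) (Ext.mk₀ (𝟙 _)) (add_zero _)
    (by rwa [Ext.comp_mk₀_id])
  rw [Ext.comp_mk₀_id] at hj
  refine hj ?_
  obtain ⟨a, b, hab, hjab⟩ := Fintype.exists_ne_map_eq_of_card_lt
    (fun a : Fin (N + 1) => j (m * a)) (by simp)
  wlog hlt : a < b generalizing a b
  · exact this b a hab.symm hjab.symm (lt_of_le_of_ne (not_lt.1 hlt) hab.symm)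
  have h1 : m * a + m ≤ m * b := by
    rw [← Nat.mul_succ]
    exact Nat.mul_le_mul_left m hlt
  have h2 : m * b ≤ m * N := Nat.mul_le_mul_left m (by omega)
  obtain ⟨u, hu⟩ : ∃ u, m * b = m * a + 1 + u := Nat.exists_eq_add_of_le (by omega)
  simp only [hu] at hjab
  refine extChain_eq_zero_of_le (a := m * a + 1 + (u + 1)) ?_ (by omega)
  rw [extChain_add]
  generalize m * (a : ℕ) = s at *
  have h3 := hvan (j s) (s + 1) (s + 1 + u + 1) (u + 1) (by omega)
    ((extChain A (fun i => V (s + 1 + i)) (fun i => (e (s + 1 + i)).comp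
      (Ext.mk₀ (ε (s + 1 + i + 1) (j (s + 1 + i)))) (add_zero 1)) u).comp (e (s + 1 + u)) rfl)
  change ((extChain A V _ s).comp ((e s).comp (Ext.mk₀ (ε (s + 1) (j s))) (add_zero 1)) rfl).comp
    ((extChain A (fun i => V (s + 1 + i)) _ u).comp ((e (s + 1 + u)).comp
      (Ext.mk₀ (ε (s + 1 + u + 1) (j (s + 1 + u)))) (add_zero 1)) rfl) rfl = 0
  rw [← hjab, ← Ext.comp_assoc_of_third_deg_zero, ← Ext.comp_assoc_of_third_deg_zero,
    Ext.comp_assoc_of_second_deg_zero]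
  rw [h3, Ext.comp_zero]

end ExtChain

section ExtCoproduct

open Abelian Limits

variable {C : Type*} [Category C] [Abelian C] [HasExt C] {ι : Type*} {D : ι → C}

/-- An extension of a coproduct is zero if its restriction to each summand is zero. -/
theorem ext_eq_zero_of_isColimit [EnoughInjectives C] {c : Cofan D} (hc : IsColimit c) {n : ℕ}
    {T : C} (x : Ext c.pt T n)
    (hx : ∀ i, (Ext.mk₀ (c.inj i)).comp x (zero_add n) = 0) : x = 0 := by
  induction n generalizing T with
  | zero =>
    obtain ⟨f, rfl⟩ := (Ext.mk₀_bijective _ _).2 x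
    rw [Ext.mk₀_eq_zero_iff]
    refine Cofan.IsColimit.hom_ext hc _ _ fun i => ?_
    rw [comp_zero, ← Ext.mk₀_eq_zero_iff, ← Ext.mk₀_comp_mk₀]
    exact hx i
  | succ n ih =>
    let S := ShortComplex.mk (Injective.ι T) (cokernel.π (Injective.ι T)) (cokernel.condition _)
    have hS : S.ShortExact := { exact := ShortComplex.exact_cokernel _ }
    have hI : ∀ {X : C} {k : ℕ} (z : Ext X S.X₂ (k + 1)), z = 0 := fun z =>
      Ext.eq_zero_of_injective (I := Injective.under T) z
    obtain ⟨y, rfl⟩ := Ext.covariant_sequence_exact₁ _ hS x (hI _) rfl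
    have hy : ∀ i, ∃ z : Ext (D i) S.X₂ n,
        z.comp (Ext.mk₀ S.g) (add_zero n) = (Ext.mk₀ (c.inj i)).comp y (zero_add n) := fun i => by
      refine Ext.covariant_sequence_exact₃ _ hS _ rfl ?_
      rw [← hx i]
      exact Ext.comp_assoc _ _ _ _ rfl (by omega)
    choose z hz using hy
    cases n with
    | zero =>
      choose f hf using fun i => (Ext.mk₀_bijective _ _).2 (z i)
      have : y = (Ext.mk₀ (Cofan.IsColimit.desc hc f)).comp (Ext.mk₀ S.g) (add_zero 0) := by
        rw [← sub_eq_zero]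
        refine ih _ fun i => ?_
        rw [sub_eq_add_neg, Ext.comp_add, Ext.comp_neg, add_neg_eq_zero, ← hz i, ← hf i,
          Ext.mk₀_comp_mk₀_assoc,
          Cofan.IsColimit.fac]
      rw [this, Ext.comp_assoc_of_second_deg_zero, hS.comp_extClass, Ext.comp_zero]
    | succ k =>
      rw [ih y fun i => by rw [← hz i, hI (z i), Ext.zero_comp], Ext.zero_comp]

/-- An extension by a product is zero if its projection to each factor is zero. -/
theorem ext_eq_zero_of_isLimit [EnoughProjectives C] {c : Fan D} (hc : IsLimit c) {n : ℕ}
    {X : C} (x : Ext X c.pt n)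
    (hx : ∀ i, x.comp (Ext.mk₀ (c.proj i)) (add_zero n) = 0) : x = 0 := by
  induction n generalizing X with
  | zero =>
    obtain ⟨f, rfl⟩ := (Ext.mk₀_bijective _ _).2 x
    rw [Ext.mk₀_eq_zero_iff]
    refine Fan.IsLimit.hom_ext hc _ _ fun i => ?_
    rw [zero_comp, ← Ext.mk₀_eq_zero_iff, ← Ext.mk₀_comp_mk₀]
    exact hx i
  | succ n ih =>
    let S := ShortComplex.mk (kernel.ι (Projective.π X)) (Projective.π X) (kernel.condition _)
    have hS : S.ShortExact := { exact := ShortComplex.exact_kernel _ }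
    have hP : ∀ {Y : C} {k : ℕ} (z : Ext S.X₂ Y (k + 1)), z = 0 := fun z =>
      Ext.eq_zero_of_projective (P := Projective.over X) z
    obtain ⟨y, rfl⟩ := Ext.contravariant_sequence_exact₃ hS _ x (hP _) (add_comm 1 n)
    have hy : ∀ i, ∃ z : Ext S.X₂ (D i) n,
        (Ext.mk₀ S.f).comp z (zero_add n) = y.comp (Ext.mk₀ (c.proj i)) (add_zero n) := fun i => by
      refine Ext.contravariant_sequence_exact₁ hS _ _ (add_comm 1 n) ?_
      rw [← hx i]
      exact (Ext.comp_assoc _ _ _ _ (add_zero n) (by omega)).symm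
    choose z hz using hy
    cases n with
    | zero =>
      choose f hf using fun i => (Ext.mk₀_bijective _ _).2 (z i)
      have : y = (Ext.mk₀ S.f).comp (Ext.mk₀ (Fan.IsLimit.lift hc f)) (add_zero 0) := by
        rw [← sub_eq_zero]
        refine ih _ fun i => ?_
        rw [sub_eq_add_neg, Ext.add_comp, Ext.neg_comp, add_neg_eq_zero, ← hz i, ← hf i,
          Ext.comp_assoc_of_second_deg_zero,
          Ext.mk₀_comp_mk₀, Ext.mk₀_comp_mk₀, Fan.IsLimit.fac,
          Ext.mk₀_comp_mk₀]
      rw [this, ← Ext.comp_assoc_of_second_deg_zero, hS.extClass_comp, Ext.zero_comp]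
    | succ k =>
      rw [ih y fun i => by rw [← hz i, hP (z i), Ext.comp_zero], Ext.comp_zero]

end ExtCoproduct

section Semisimple

open Abelian Limits

variable {A : Type} [Ring A] {J : Ideal A}

/-- A semisimple module annihilated by `J` is a direct sum of simple modules, and extensions from
or to it are detected on its simple summands. Any coloring of the summands by a finite set yields
a decomposition of the identity into projections onto the summands of the same color. -/
theorem exists_simple_decomposition [IsSemisimpleModule A (A ⧸ J)]
    (h3 : ∀ x ∈ J, ∀ y ∈ J, ∀ z ∈ J, x * y * z = 0) (V : ModuleCat.{0} A)
    (hV : IsSemisimpleModule A V) :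
    ∃ (ι : Type) (D : ι → ModuleCat.{0} A) (inj : ∀ i, D i ⟶ V) (pr : ∀ i, V ⟶ D i),
      (∀ i, IsSimpleModule A (D i)) ∧ (∀ i, inj i ≫ pr i = 𝟙 (D i)) ∧
      (∀ (T : ModuleCat.{0} A) (n : ℕ) (x : Ext V T n),
        (∀ i, (Ext.mk₀ (inj i)).comp x (zero_add n) = 0) → x = 0) ∧
      (∀ (X : ModuleCat.{0} A) (n : ℕ) (x : Ext X V n),
        (∀ i, x.comp (Ext.mk₀ (pr i)) (add_zero n) = 0) → x = 0) ∧
      ∀ (N : ℕ) (t : ι → Fin N), ∃ ε : Fin N → (V ⟶ V), ∑ j, ε j = 𝟙 V ∧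
        (∀ i j, inj i ≫ ε j = if t i = j then inj i else 0) ∧
        ∀ i j, ε j ≫ pr i = if t i = j then pr i else 0 := by
  classical
  obtain ⟨s, e, hs⟩ := isSemisimpleModule_iff_exists_linearEquiv_dfinsupp.1 hV
  let D : s → ModuleCat.{0} A := fun m => ModuleCat.of A m.1
  let c := ModuleCat.coproductCocone.{0, 0, 0} D
  have hc : IsColimit c := ModuleCat.coproductCoconeIsColimit D
  let d := ModuleCat.productCone.{0, 0, 0} D
  have hd : IsLimit d := ModuleCat.productConeIsLimit D
  let W : ModuleCat.{0} A := ModuleCat.of A (Π₀ m : s, m.1)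
  let u : V ⟶ c.pt := (ModuleCat.ofHom e.toLinearMap : V ⟶ W)
  let v : c.pt ⟶ V := (ModuleCat.ofHom e.symm.toLinearMap : W ⟶ V)
  have huv : u ≫ v = 𝟙 V := by
    ext x
    exact e.symm_apply_apply x
  have hvu : v ≫ u = 𝟙 c.pt := by
    refine ModuleCat.hom_ext (LinearMap.ext fun x => ?_)
    exact e.apply_symm_apply x
  let q : ∀ i, c.pt ⟶ D i := fun i =>
    (ModuleCat.ofHom (DFinsupp.lapply (R := A) (M := fun m : s => m.1) i) : W ⟶ D i)
  have hq : ∀ i k, c.inj i ≫ q k = if h : i = k then eqToHom (by rw [h]) else 0 := fun i k => by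
    split_ifs with h
    · subst h
      refine ModuleCat.hom_ext (LinearMap.ext fun x => ?_)
      exact DFinsupp.single_eq_same
    · refine ModuleCat.hom_ext (LinearMap.ext fun x => ?_)
      exact DFinsupp.single_eq_of_ne (Ne.symm h)
  have : EnoughInjectives (ModuleCat.{0} A) := ModuleCat.enoughInjectives.{0, 0} A
  refine ⟨s, D, fun i => c.inj i ≫ v, fun i => u ≫ q i, hs, fun i => ?_, fun T n x hx => ?_,
    fun X n x hx => ?_, fun N t => ?_⟩
  · rw [Category.assoc, reassoc_of% hvu, hq, dif_pos rfl, eqToHom_refl]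
  · have h0 : (Ext.mk₀ v).comp x (zero_add n) = 0 :=
      ext_eq_zero_of_isColimit hc _ fun i => by rw [Ext.mk₀_comp_mk₀_assoc, hx]
    rw [← Ext.mk₀_id_comp x, ← huv, ← Ext.mk₀_comp_mk₀_assoc, h0, Ext.comp_zero]
  · let κ : V ⟶ d.pt := Fan.IsLimit.lift hd fun i => u ≫ q i
    have hκq : ∀ i x, (d.proj i).hom (κ.hom x) = e x i := fun i x =>
      LinearMap.congr_fun (ModuleCat.hom_ext_iff.1 (Fan.IsLimit.fac hd (fun i => u ≫ q i) i)) x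
    have hκ : Function.Injective κ.hom := fun x y hxy =>
      e.injective (DFinsupp.ext fun i => by rw [← hκq, ← hκq, hxy])
    have : IsSemisimpleModule A d.pt :=
      isSemisimpleModule_of_forall_smul_eq_zero (J := J) fun a ha m =>
        funext fun i => smul_eq_zero_of_isSimpleModule h3 a ha (m i)
    obtain ⟨ρ, hρ⟩ := IsSemisimpleModule.extension_property κ.hom hκ LinearMap.id
    let ρ' : d.pt ⟶ V := ModuleCat.ofHom ρ
    have h1 : κ ≫ ρ' = 𝟙 V := ModuleCat.hom_ext hρ
    have h0 : x.comp (Ext.mk₀ κ) (add_zero n) = 0 :=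
      ext_eq_zero_of_isLimit hd _ fun i => by
        rw [Ext.comp_assoc_of_third_deg_zero, Ext.mk₀_comp_mk₀, Fan.IsLimit.fac, hx]
    rw [← Ext.comp_mk₀_id x, ← h1, ← Ext.mk₀_comp_mk₀, ← Ext.comp_assoc_of_third_deg_zero, h0,
      Ext.zero_comp]
  · let φ : Fin N → (c.pt ⟶ c.pt) := fun j =>
      Cofan.IsColimit.desc hc fun i => if t i = j then c.inj i else 0
    have hφ : ∀ i j, c.inj i ≫ φ j = if t i = j then c.inj i else 0 := fun i j =>
      Cofan.IsColimit.fac hc _ _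
    have hφ' : ∀ i j, φ j ≫ q i = if t i = j then q i else 0 := fun i j => by
      refine Cofan.IsColimit.hom_ext hc _ _ fun k => ?_
      rw [reassoc_of% hφ k j]
      by_cases hik : k = i
      · subst hik
        split_ifs <;> simp
      · have := hq k i
        rw [dif_neg hik] at this
        split_ifs <;> simp [this]
    have hφs : ∑ j, φ j = 𝟙 c.pt := by
      refine Cofan.IsColimit.hom_ext hc _ _ fun k => ?_
      rw [Preadditive.comp_sum]
      simp [hφ]
    refine ⟨fun j => u ≫ φ j ≫ v, ?_, fun i j => ?_, fun i j => ?_⟩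
    · rw [← Preadditive.comp_sum, ← Preadditive.sum_comp, hφs, Category.id_comp, huv]
    · rw [Category.assoc, reassoc_of% hvu, reassoc_of% hφ i j]
      split_ifs <;> simp
    · rw [Category.assoc, Category.assoc, reassoc_of% hvu, hφ']
      split_ifs <;> simp

/-- A simple module annihilated by `J` is a quotient, hence a summand, of `A ⧸ J`, so there are
finitely many simple modules up to isomorphism. -/
theorem exists_finite_simple_representatives [IsSemisimpleModule A (A ⧸ J)]
    (h3 : ∀ x ∈ J, ∀ y ∈ J, ∀ z ∈ J, x * y * z = 0) :
    ∃ (N : ℕ) (S : Fin N → ModuleCat.{0} A), (∀ j, IsSimpleModule A (S j)) ∧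
      ∀ T : ModuleCat.{0} A, IsSimpleModule A T → ∃ j, Nonempty (T ≅ S j) := by
  obtain ⟨N, S, e, hS⟩ := IsSemisimpleModule.exists_linearEquiv_fin_dfinsupp A (A ⧸ J)
  refine ⟨N, fun j => ModuleCat.of A (S j), hS, fun T hT => ?_⟩
  have : Nontrivial T := IsSimpleModule.nontrivial A T
  obtain ⟨x, hx⟩ := exists_ne (0 : T)
  let f : (A ⧸ J) →ₗ[A] T := Submodule.liftQ J (LinearMap.toSpanSingleton A T x)
    fun a ha => by simpa using smul_eq_zero_of_isSimpleModule h3 a ha x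
  by_contra! h
  refine hx ?_
  have hf : f ∘ₗ e.symm.toLinearMap = 0 := by
    refine DFinsupp.lhom_ext' fun j => ?_
    by_contra h0
    have hb := LinearMap.bijective_of_ne_zero h0
    exact (h j).false (LinearEquiv.ofBijective _ hb).symm.toModuleIso
  have h1 : f (Submodule.Quotient.mk 1) = x := by simp [f]
  rw [← h1, ← e.symm_apply_apply (Submodule.Quotient.mk 1)]
  exact LinearMap.congr_fun hf _

end Semisimple

section SimpleModules

open Abelian

variable {A : Type} [Ring A] {J : Ideal A}

theorem subsingleton_ext_of_iso {S T S' T' : ModuleCat.{0} A} (a : S ≅ S') (b : T ≅ T') {n : ℕ}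
    (h : Subsingleton (Ext S' T' n)) : Subsingleton (Ext S T n) := by
  refine subsingleton_of_forall_eq 0 fun x => ?_
  have h0 : (Ext.mk₀ a.inv).comp (x.comp (Ext.mk₀ b.hom) (add_zero n)) (zero_add n) = 0 :=
    Subsingleton.elim _ _
  have hx : (Ext.mk₀ a.hom).comp ((Ext.mk₀ a.inv).comp (x.comp (Ext.mk₀ b.hom) (add_zero n))
      (zero_add n)) (zero_add n) = x.comp (Ext.mk₀ b.hom) (add_zero n) := by
    rw [Ext.mk₀_comp_mk₀_assoc, a.hom_inv_id, Ext.mk₀_id_comp]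
  rw [← Ext.comp_mk₀_id x, ← b.hom_inv_id, ← Ext.mk₀_comp_mk₀,
    ← Ext.comp_assoc_of_third_deg_zero, ← hx, h0, Ext.comp_zero, Ext.zero_comp]

/-- The projective dimension of a semisimple module is controlled by its simple summands. -/
theorem hasProjectiveDimensionLT_of_isSemisimpleModule [IsSemisimpleModule A (A ⧸ J)]
    (h3 : ∀ x ∈ J, ∀ y ∈ J, ∀ z ∈ J, x * y * z = 0) {V : ModuleCat.{0} A}
    (hV : IsSemisimpleModule A V) {d : ℕ}
    (h : ∀ (T : ModuleCat.{0} A) (i : T ⟶ V) (p : V ⟶ T), IsSimpleModule A T → i ≫ p = 𝟙 T →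
      HasProjectiveDimensionLT T d) : HasProjectiveDimensionLT V d := by
  obtain ⟨ι, D, inj, pr, hD, hinj, hdet, -⟩ := exists_simple_decomposition h3 V hV
  refine (hasProjectiveDimensionLT_iff V d).2 fun n hn Y x => hdet _ _ _ fun i => ?_
  have := h _ _ _ (hD i) (hinj i)
  exact Ext.eq_zero_of_hasProjectiveDimensionLT _ d hn

/-- If self-extensions of simple modules vanish in large degrees, then so do long Yoneda products
of extensions of degree one between semisimple modules. -/
theorem exists_extChain_eq_zero_of_isSemisimpleModule [IsSemisimpleModule A (A ⧸ J)]
    (h3 : ∀ x ∈ J, ∀ y ∈ J, ∀ z ∈ J, x * y * z = 0)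
    (hext : ∀ S : ModuleCat.{0} A, IsSimpleModule A S →
      ∃ m : ℕ, ∀ n : ℕ, m ≤ n → Subsingleton (Ext S S n))
    {V : ℕ → ModuleCat.{0} A} (hV : ∀ n, IsSemisimpleModule A (V n))
    (e : ∀ i : ℕ, Ext (V i) (V (i + 1)) 1) : ∃ n, 1 ≤ n ∧ extChain A V e n = 0 := by
  obtain ⟨N, S, hS, hrep⟩ := exists_finite_simple_representatives (A := A) h3
  choose m hm using fun j => hext (S j) (hS j)
  choose ι D inj pr hD _ hdet hdet' hε using fun n => exists_simple_decomposition h3 (V n) (hV n)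
  choose t ht using fun n i => hrep (D n i) (hD n i)
  choose ε hεs hinj hpr using fun n => hε n N (t n)
  refine exists_extChain_eq_zero ε hεs (m := (∑ j, m j) + 1) (by omega)
    (fun j a b q hq y => hdet _ _ _ _ fun i => hdet' _ _ _ _ fun k => ?_) e
  rw [Ext.mk₀_comp_mk₀_assoc, Ext.comp_assoc_of_third_deg_zero, Ext.comp_assoc_of_third_deg_zero,
    Ext.mk₀_comp_mk₀, hinj, hpr]
  split_ifs with h1 h2 h2
  · have hj : m j ≤ q := (Finset.single_le_sum (fun _ _ => Nat.zero_le _)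
      (Finset.mem_univ j)).trans ((Nat.le_succ _).trans hq)
    have := subsingleton_ext_of_iso (ht a i).some (ht b k).some (n := q)
      (by rw [h1, h2]; exact hm j q hj)
    exact Subsingleton.elim _ _
  · rw [Ext.mk₀_zero, Ext.comp_zero, Ext.comp_zero]
  · rw [Ext.mk₀_zero, Ext.zero_comp]
  · rw [Ext.mk₀_zero, Ext.zero_comp]

theorem hasProjectiveDimensionLT_one_of_cancelsLeft {S : ModuleCat.{0} A} {m n : ℕ}
    (hext : ∀ k, m ≤ k → Subsingleton (Ext S S k)) (hn : 1 ≤ n) {ω : Ext S S n}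
    (hω : CancelsLeft ω) : HasProjectiveDimensionLT S 1 := by
  have hpow : ∀ l, ∃ (k : ℕ) (υ : Ext S S k), l ≤ k ∧ CancelsLeft υ := fun l => by
    induction l with
    | zero => exact ⟨n, ω, by omega, hω⟩
    | succ l ih =>
      obtain ⟨k, υ, hk, hυ⟩ := ih
      exact ⟨k + n, υ.comp ω rfl, by omega, hυ.comp hω rfl⟩
  obtain ⟨k, υ, hk, hυ⟩ := hpow m
  have := hext k hk
  refine (hasProjectiveDimensionLT_iff S 1).2 fun i hi Y z => hυ rfl hi z ?_
  rw [Subsingleton.elim υ 0, Ext.zero_comp]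

/-- If self-extensions of simple modules vanish in large degrees and some simple module has
infinite projective dimension, there is such a simple module `S` for which left Yoneda
multiplication by an extension of positive degree from `S` to a simple module `T` of infinite
projective dimension is never injective in positive degrees. -/
theorem exists_isSimpleModule_forall_not_cancelsLeft [IsSemisimpleModule A (A ⧸ J)]
    (h3 : ∀ x ∈ J, ∀ y ∈ J, ∀ z ∈ J, x * y * z = 0)
    (hext : ∀ S : ModuleCat.{0} A, IsSimpleModule A S →
      ∃ m : ℕ, ∀ n : ℕ, m ≤ n → Subsingleton (Ext S S n))
    {S₀ : ModuleCat.{0} A} (hS₀ : IsSimpleModule A S₀)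
    (hpd : ∀ d, ¬ HasProjectiveDimensionLT S₀ d) :
    ∃ S : ModuleCat.{0} A, (∀ d, ¬ HasProjectiveDimensionLT S d) ∧
      ∀ T : ModuleCat.{0} A, IsSimpleModule A T → (∀ d, ¬ HasProjectiveDimensionLT T d) →
        ∀ (n : ℕ) (ω : Ext S T n), 1 ≤ n → ¬ CancelsLeft ω := by
  obtain ⟨N, S, hS, hrep⟩ := exists_finite_simple_representatives (A := A) h3
  let I := {j : Fin N // ∀ d, ¬ HasProjectiveDimensionLT (S j) d}
  have hI : ∀ T : ModuleCat.{0} A, IsSimpleModule A T → (∀ d, ¬ HasProjectiveDimensionLT T d) →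
      ∃ j : I, Nonempty (T ≅ S j.1) := fun T hT hTd => by
    obtain ⟨j, ⟨a⟩⟩ := hrep T hT
    refine ⟨⟨j, fun d hd => hTd d ?_⟩, ⟨a⟩⟩
    exact hasProjectiveDimensionLT_of_iso a.symm d
  let R : I → I → Prop := fun a b => ∃ (n : ℕ) (ω : Ext (S b.1) (S a.1) n), 1 ≤ n ∧ CancelsLeft ω
  have : IsTrans I R := ⟨by
    rintro a b c ⟨n, ω, hn, hω⟩ ⟨k, υ, hk, hυ⟩
    exact ⟨k + n, υ.comp ω rfl, by omega, hυ.comp hω rfl⟩⟩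
  have : Std.Irrefl R := ⟨by
    rintro a ⟨n, ω, hn, hω⟩
    obtain ⟨m, hm⟩ := hext _ (hS a.1)
    exact a.2 1 (hasProjectiveDimensionLT_one_of_cancelsLeft hm hn hω)⟩
  obtain ⟨j₀, -⟩ := hI S₀ hS₀ hpd
  obtain ⟨j, -, hj⟩ := (Finite.wellFounded_of_trans_of_irrefl R).has_min Set.univ ⟨j₀, trivial⟩
  refine ⟨S j.1, j.2, fun T hT hTd n ω hn hω => ?_⟩
  obtain ⟨k, ⟨a⟩⟩ := hI T hT hTd
  exact hj k trivial ⟨n, ω.comp (Ext.mk₀ a.hom) (add_zero n), hn,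
    hω.comp (cancelsLeft_mk₀_of_section a.inv_hom_id) _⟩

/-- Projective dimensions of simple modules of finite projective dimension are bounded. -/
theorem exists_bound_projectiveDimension [IsSemisimpleModule A (A ⧸ J)]
    (h3 : ∀ x ∈ J, ∀ y ∈ J, ∀ z ∈ J, x * y * z = 0) :
    ∃ d, ∀ T : ModuleCat.{0} A, IsSimpleModule A T → (∃ n, HasProjectiveDimensionLT T n) →
      HasProjectiveDimensionLT T d := by
  obtain ⟨N, S, hS, hrep⟩ := exists_finite_simple_representatives (A := A) h3
  have : ∀ j, ∃ d, (∃ n, HasProjectiveDimensionLT (S j) n) → HasProjectiveDimensionLT (S j) d :=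
    fun j => by
      by_cases h : ∃ n, HasProjectiveDimensionLT (S j) n
      · exact ⟨h.choose, fun _ => h.choose_spec⟩
      · exact ⟨0, fun h' => absurd h' h⟩
  choose d hd using this
  refine ⟨∑ j, d j, fun T hT ⟨n, hn⟩ => ?_⟩
  obtain ⟨j, ⟨a⟩⟩ := hrep T hT
  have := hd j ⟨n, hasProjectiveDimensionLT_of_iso a n⟩
  have := hasProjectiveDimensionLT_of_iso a.symm (d j)
  exact hasProjectiveDimensionLT_of_ge T (d j) _
    (Finset.single_le_sum (fun _ _ => Nat.zero_le _) (Finset.mem_univ j))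

theorem cancelsLeft_extChain {V : ℕ → ModuleCat.{0} A} {e : ∀ i : ℕ, Ext (V i) (V (i + 1)) 1}
    (h : ∀ i, CancelsLeft (e i)) (n : ℕ) : CancelsLeft (extChain A V e n) := by
  induction n with
  | zero => exact cancelsLeft_mk₀_of_section (Category.id_comp (𝟙 (V 0)))
  | succ n ih => exact ih.comp (h n) rfl

theorem extChain_comp_mk₀ {M V : ℕ → ModuleCat.{0} A} {e : ∀ i : ℕ, Ext (M i) (M (i + 1)) 1}
    {e' : ∀ i : ℕ, Ext (V i) (V (i + 1)) 1} {f : ∀ i, M i ⟶ V i}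
    (h : ∀ i, (e i).comp (Ext.mk₀ (f (i + 1))) (add_zero 1) =
      (Ext.mk₀ (f i)).comp (e' i) (zero_add 1)) (n : ℕ) :
    (extChain A M e n).comp (Ext.mk₀ (f n)) (add_zero n) =
      (Ext.mk₀ (f 0)).comp (extChain A V e' n) (zero_add n) := by
  induction n with
  | zero => exact (Ext.mk₀_id_comp _).trans (Ext.comp_mk₀_id _).symm
  | succ n ih =>
    refine (Ext.comp_assoc_of_third_deg_zero _ _ _ _).trans ?_
    rw [h, ← Ext.comp_assoc_of_second_deg_zero, ih]
    exact Ext.comp_assoc _ _ _ _ rfl (by omega)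

/-- If `A ⧸ J` is semisimple, `J ^ 3 = 0` and self-extensions of simple modules vanish in large
degrees, then simple modules have finite projective dimension. -/
theorem exists_hasProjectiveDimensionLT_of_isSimpleModule [IsSemisimpleModule A (A ⧸ J)]
    (h3 : ∀ x ∈ J, ∀ y ∈ J, ∀ z ∈ J, x * y * z = 0)
    (hext : ∀ S : ModuleCat.{0} A, IsSimpleModule A S →
      ∃ m : ℕ, ∀ n : ℕ, m ≤ n → Subsingleton (Ext S S n))
    {S₀ : ModuleCat.{0} A} (hS₀ : IsSimpleModule A S₀) :
    ∃ d, HasProjectiveDimensionLT S₀ d := by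
  by_contra! hpd
  obtain ⟨S, hSd, hS⟩ := exists_isSimpleModule_forall_not_cancelsLeft h3 hext hS₀ hpd
  obtain ⟨d, hd⟩ := exists_bound_projectiveDimension (A := A) h3
  let State := {M : ModuleCat.{0} A // (∀ d, ¬ HasProjectiveDimensionLT M d) ∧
    ∃ (k : ℕ) (ω : Ext S M k), CancelsLeft ω}
  have step : ∀ s : State, ∃ (s' : State) (ω : Ext s.1 s'.1 1)
      (η : Ext (head J s.1) (head J s'.1) 1), CancelsLeft ω ∧
        ω.comp (Ext.mk₀ (toHead J s'.1)) (add_zero 1) =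
          (Ext.mk₀ (toHead J s.1)).comp η (zero_add 1) ∧
        ω.comp (Ext.mk₀ (toHead J s'.1)) (add_zero 1) ≠ 0 := by
    rintro ⟨M, hM, k, α, hα⟩
    obtain ⟨M', Y, ω, υ, η, hY, hω, hυ, hωη, hne, hdim⟩ := exists_syzygy_step h3 M
    have hYd : HasProjectiveDimensionLT Y d := by
      refine hasProjectiveDimensionLT_of_isSemisimpleModule h3 hY fun T i p hT hip => hd T hT ?_
      by_contra! hTd
      exact hS T hT hTd (k + 1 + 0) ((α.comp υ rfl).comp (Ext.mk₀ p) rfl) (by omega)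
        ((hα.comp hυ rfl).comp (cancelsLeft_mk₀_of_section hip) rfl)
    have hM' : ∀ n, ¬ HasProjectiveDimensionLT M' n := fun n hn =>
      hM _ (hdim (n + d) (hasProjectiveDimensionLT_of_ge _ n _ (by omega))
        (hasProjectiveDimensionLT_of_ge _ d _ (by omega)))
    refine ⟨⟨M', hM', k + 1, α.comp ω rfl, hα.comp hω rfl⟩, ω, η, hω, hωη, hne ?_⟩
    by_contra hnt
    have := not_nontrivial_iff_subsingleton.1 hnt
    exact hM' 0 (ModuleCat.isZero_of_subsingleton M').hasProjectiveDimensionLT_zero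
  choose next ω η hω hωη hne using step
  let s : ℕ → State := fun n => Nat.rec
    ⟨S, hSd, 0, Ext.mk₀ (𝟙 S), cancelsLeft_mk₀_of_section (Category.id_comp (𝟙 S))⟩
    (fun _ t => next t) n
  have hV : ∀ n, IsSemisimpleModule A (head J (s n).1) := fun n =>
    isSemisimpleModule_of_forall_smul_eq_zero (J := J) smul_quotient_smul_top_eq_zero
  obtain ⟨n, hn, h0⟩ := exists_extChain_eq_zero_of_isSemisimpleModule h3 hext
    (V := fun n => head J (s n).1) hV fun i => η (s i)
  obtain ⟨n, rfl⟩ : ∃ k, n = k + 1 := ⟨n - 1, by omega⟩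
  have h1 := extChain_comp_mk₀ (M := fun n => (s n).1) (e := fun i => ω (s i))
    (f := fun i => toHead J (s i).1) (fun i => hωη (s i)) (n + 1)
  rw [h0, Ext.comp_zero] at h1
  refine hne (s n) (cancelsLeft_extChain (V := fun n => (s n).1) (fun i => hω (s i)) n rfl le_rfl _
    ((Ext.comp_assoc_of_third_deg_zero _ _ _ _).symm.trans h1))

end SimpleModules

section GlobalDimension

open Abelian

variable {A : Type} [Ring A]

theorem hasProjectiveDimensionLT_of_smul_top {J : Ideal A} (M : ModuleCat.{0} A) {d : ℕ}
    (h₁ : HasProjectiveDimensionLT (ModuleCat.of A (J • ⊤ : Submodule A M)) d)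
    (h₂ : HasProjectiveDimensionLT (head J M) d) : HasProjectiveDimensionLT M d := by
  have hS := LinearMap.shortExact_shortComplexKer
    (Submodule.mkQ_surjective (J • ⊤ : Submodule A M))
  refine hS.hasProjectiveDimensionLT_X₂ d ?_ h₂
  exact hasProjectiveDimensionLT_of_iso
    (LinearEquiv.ofEq _ _ (Submodule.ker_mkQ (J • ⊤ : Submodule A M)).symm).toModuleIso d

/-- If `A ⧸ J` is semisimple and `J ^ 3 = 0`, a bound on the projective dimension of simple modules
is a bound on the projective dimension of all modules. -/
theorem hasProjectiveDimensionLT_of_forall_isSimpleModule {J : Ideal A}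
    [IsSemisimpleModule A (A ⧸ J)] (h3 : ∀ x ∈ J, ∀ y ∈ J, ∀ z ∈ J, x * y * z = 0) {d : ℕ}
    (hd : ∀ T : ModuleCat.{0} A, IsSimpleModule A T → HasProjectiveDimensionLT T d)
    (M : ModuleCat.{0} A) : HasProjectiveDimensionLT M d := by
  have hss : ∀ V : ModuleCat.{0} A, (∀ a ∈ J, ∀ v : V, a • v = 0) → HasProjectiveDimensionLT V d :=
    fun V hV => hasProjectiveDimensionLT_of_isSemisimpleModule h3
      (isSemisimpleModule_of_forall_smul_eq_zero hV) fun T _ _ hT _ => hd T hT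
  have hhead : ∀ V : ModuleCat.{0} A, HasProjectiveDimensionLT (head J V) d := fun V =>
    hss _ smul_quotient_smul_top_eq_zero
  refine hasProjectiveDimensionLT_of_smul_top M
    (hasProjectiveDimensionLT_of_smul_top _ (hss _ fun a ha x => ?_) (hhead _)) (hhead M)
  exact Subtype.ext (Subtype.ext (smul_eq_zero_of_mem_smul_smul h3 ha
    (map_mem_smul (f := (J • ⊤ : Submodule A M).subtype) (fun y _ => y.2) x.2)))

theorem isSemisimpleModule_quotient_jrad (hss : SemisimpleModJ A) :
    IsSemisimpleModule A (A ⧸ (jrad A).asIdeal) := by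
  have : IsSemisimpleRing (jrad A).ringCon.Quotient := hss
  let σ : A →+* (jrad A).ringCon.Quotient := (jrad A).ringCon.mk'
  have : RingHomSurjective σ := ⟨RingCon.mk'_surjective _⟩
  have hσ : ∀ a, a ∈ (jrad A).asIdeal ↔ σ a = 0 := fun a => by
    rw [TwoSidedIdeal.mem_asIdeal]
    exact ((jrad A).mem_iff a).trans (RingCon.eq _).symm
  let g : A →ₛₗ[σ] (jrad A).ringCon.Quotient :=
    { toFun := σ
      map_add' := map_add σ
      map_smul' := map_mul σ }
  let f : A ⧸ (jrad A).asIdeal →ₛₗ[σ] (jrad A).ringCon.Quotient :=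
    Submodule.liftQ _ g fun a ha => (hσ a).1 ha
  refine (LinearMap.isSemisimpleModule_iff_of_bijective f ⟨?_, fun y => ?_⟩).2 inferInstance
  · refine (injective_iff_map_eq_zero f).2 fun x hx => ?_
    obtain ⟨a, rfl⟩ := Submodule.Quotient.mk_surjective _ x
    exact (Submodule.Quotient.mk_eq_zero _).2 ((hσ a).2 hx)
  · obtain ⟨a, rfl⟩ := RingCon.mk'_surjective _ y
    exact ⟨Submodule.Quotient.mk a, rfl⟩

theorem sInf_natCast_ne_top_iff {p : ℕ → Prop} :
    sInf {e : ℕ∞ | ∃ n : ℕ, e = n ∧ p n} ≠ ⊤ ↔ ∃ n, p n := by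
  refine ⟨fun h => ?_, fun ⟨n, hn⟩ =>
    ne_top_of_le_ne_top (ENat.natCast_ne_top n) (sInf_le ⟨n, rfl, hn⟩)⟩
  by_contra! hp
  exact h (sInf_eq_top.2 fun _ ⟨n, _, hn⟩ => absurd hn (hp n))

theorem projDim_ne_top_iff {M : ModuleCat.{0} A} : projDim A M ≠ ⊤ ↔ ∃ n, projDimLE A M n :=
  sInf_natCast_ne_top_iff

theorem injDim_ne_top_iff {M : ModuleCat.{0} A} : injDim A M ≠ ⊤ ↔ ∃ n, injDimLE A M n :=
  sInf_natCast_ne_top_iff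

theorem projDim_ne_top_of_globalDim_ne_top (h : globalDim A ≠ ⊤) (M : ModuleCat.{0} A) :
    projDim A M ≠ ⊤ :=
  ne_top_of_le_ne_top h (le_iSup (projDim A) M)

theorem globalDim_ne_top_of_forall_hasProjectiveDimensionLT {d : ℕ}
    (h : ∀ M : ModuleCat.{0} A, HasProjectiveDimensionLT M d) : globalDim A ≠ ⊤ := by
  refine ne_top_of_le_ne_top (ENat.natCast_ne_top d) (iSup_le fun M => sInf_le ⟨d, rfl, ?_⟩)
  exact fun N k hk => HasProjectiveDimensionLT.subsingleton M d k hk.le N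

theorem exists_subsingleton_ext_self {M : ModuleCat.{0} A}
    (h : projDim A M ≠ ⊤ ∨ injDim A M ≠ ⊤) :
    ∃ m : ℕ, ∀ n : ℕ, m ≤ n → Subsingleton (Ext M M n) := by
  rcases h with h | h
  · obtain ⟨m, hm⟩ := projDim_ne_top_iff.1 h
    exact ⟨m + 1, fun n hn => hm M n hn⟩
  · obtain ⟨m, hm⟩ := injDim_ne_top_iff.1 h
    exact ⟨m + 1, fun n hn => hm M n hn⟩

theorem globalDim_ne_top_of_subsingleton_ext_self (hss : SemisimpleModJ A) (h3 : JCubeZero A)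
    (hext : ∀ S : ModuleCat.{0} A, IsSimpleModule A S →
      ∃ m : ℕ, ∀ n : ℕ, m ≤ n → Subsingleton (Ext S S n)) : globalDim A ≠ ⊤ := by
  have := isSemisimpleModule_quotient_jrad hss
  have h3' : ∀ x ∈ (jrad A).asIdeal, ∀ y ∈ (jrad A).asIdeal, ∀ z ∈ (jrad A).asIdeal,
      x * y * z = 0 := fun x hx y hy z hz => h3 x y z
    (TwoSidedIdeal.mem_asIdeal.1 hx) (TwoSidedIdeal.mem_asIdeal.1 hy)
    (TwoSidedIdeal.mem_asIdeal.1 hz)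
  obtain ⟨d, hd⟩ := exists_bound_projectiveDimension (A := A) h3'
  exact globalDim_ne_top_of_forall_hasProjectiveDimensionLT
    (hasProjectiveDimensionLT_of_forall_isSimpleModule h3' fun T hT =>
      hd T hT (exists_hasProjectiveDimensionLT_of_isSimpleModule h3' hext hT))

end GlobalDimension

/-- For a ring with `A/J` semisimple and `J³ = 0`, the following are equivalent:
(1) finite global dimension; (2) `Ext^n(S,S) = 0` for every simple `S` and all
`n ≫ 0`; (3) every simple module has finite projective or finite injective
dimension. -/
theorem stmt_14 (A : Type) [Ring A] (hss : SemisimpleModJ A) (h3 : JCubeZero A) :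
    (globalDim A ≠ ⊤ ↔
      ∀ S : ModuleCat.{0} A, IsSimpleModule A S →
        ∃ m : ℕ, ∀ n : ℕ, m ≤ n → Subsingleton (Abelian.Ext S S n)) ∧
    (globalDim A ≠ ⊤ ↔
      ∀ S : ModuleCat.{0} A, IsSimpleModule A S →
        projDim A S ≠ ⊤ ∨ injDim A S ≠ ⊤) := by
  refine ⟨⟨fun h S _ => exists_subsingleton_ext_self (.inl ?_),
    globalDim_ne_top_of_subsingleton_ext_self hss h3⟩, fun h S _ => .inl ?_,
    fun h => globalDim_ne_top_of_subsingleton_ext_self hss h3 fun S hS =>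
      exists_subsingleton_ext_self (h S hS)⟩
  · exact projDim_ne_top_of_globalDim_ne_top h S
  · exact projDim_ne_top_of_globalDim_ne_top h S

end
end

section
/- Let A be a ring with A/J semisimple and J^3 = 0, and assume Ext_A^n(T, T) = 0 for all simple T and all n ≥ m, for some fixed m. Let r be the number of isomorphism classes of simple A-modules. Then for every simple module S, the associated sequence (M_0 = S, M_1, M_2, ...) satisfies M_n = 0 for all n > m·r. -/
open CategoryTheory

noncomputable section

section Homological

open Abelian

variable {A : Type} [Ring A]

/-- Dimension shifting in degrees at least two. -/
lemma subsingleton_ext_succ_succ_iff {S : ShortComplex (ModuleCat.{0} A)} (hS : S.ShortExact)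
    [Projective S.X₂] (N : ModuleCat.{0} A) (k : ℕ) :
    Subsingleton (Ext S.X₃ N (k + 2)) ↔ Subsingleton (Ext S.X₁ N (k + 1)) := by
  refine ⟨fun h ↦ subsingleton_of_forall_eq 0 fun x ↦ ?_,
    fun h ↦ subsingleton_of_forall_eq 0 fun y ↦ ?_⟩
  · obtain ⟨y, rfl⟩ := Ext.contravariant_sequence_exact₁ hS N x (add_comm 1 (k + 1))
      (Subsingleton.elim _ _)
    rw [Ext.eq_zero_of_projective y, Ext.comp_zero]
  · obtain ⟨x, rfl⟩ := Ext.contravariant_sequence_exact₃ hS N y (Ext.eq_zero_of_projective _)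
      (add_comm 1 (k + 1))
    rw [Subsingleton.elim x 0, Ext.comp_zero]

/-- Dimension shifting in degree one. -/
lemma subsingleton_ext_one_iff {S : ShortComplex (ModuleCat.{0} A)} (hS : S.ShortExact)
    [Projective S.X₂] (N : ModuleCat.{0} A) :
    Subsingleton (Ext S.X₃ N 1) ↔ ∀ f : S.X₁ ⟶ N, ∃ g : S.X₂ ⟶ N, S.f ≫ g = f := by
  refine ⟨fun h f ↦ ?_, fun h ↦ subsingleton_of_forall_eq 0 fun y ↦ ?_⟩
  · obtain ⟨y, hy⟩ := Ext.contravariant_sequence_exact₁ hS N (Ext.mk₀ f) (add_zero 1)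
      (Subsingleton.elim _ _)
    obtain ⟨g, rfl⟩ := (Ext.mk₀_bijective _ _).2 y
    rw [Ext.mk₀_comp_mk₀] at hy
    exact ⟨g, (Ext.mk₀_bijective _ _).1 hy⟩
  · obtain ⟨x, rfl⟩ := Ext.contravariant_sequence_exact₃ hS N y (Ext.eq_zero_of_projective _)
      (add_zero 1)
    obtain ⟨f, rfl⟩ := (Ext.mk₀_bijective _ _).2 x
    obtain ⟨g, rfl⟩ := h f
    rw [← Ext.mk₀_comp_mk₀, hS.extClass_comp_assoc]

lemma subsingleton_ext_zero_iff (M N : ModuleCat.{0} A) :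
    Subsingleton (Ext M N 0) ↔ ∀ f : M →ₗ[A] N, f = 0 := by
  refine (Ext.homEquiv₀.trans ModuleCat.homEquiv).subsingleton_congr.trans
    ⟨fun h f ↦ Subsingleton.elim _ _, subsingleton_of_forall_eq 0⟩

instance (M : ModuleCat.{0} A) : Projective M.projectiveShortComplex.X₂ :=
  ModuleCat.projective_of_free (Module.Free.chooseBasis A M.projectiveShortComplex.X₂)

/-- `Ext^n(M, -)` vanishes on powers of a module on which it vanishes. -/
lemma subsingleton_ext_pi (X : Type) (N : ModuleCat.{0} A) (n : ℕ) (M : ModuleCat.{0} A)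
    (h : Subsingleton (Ext M N n)) : Subsingleton (Ext M (ModuleCat.of A (X → N)) n) := by
  induction n using Nat.twoStepInduction generalizing M with
  | zero =>
    rw [subsingleton_ext_zero_iff] at h ⊢
    intro f
    ext m x
    exact congr($(h (LinearMap.proj x ∘ₗ f)) m)
  | one =>
    have hS := M.shortExact_projectiveShortComplex
    have h' := (subsingleton_ext_one_iff hS N).1 h
    refine (subsingleton_ext_one_iff hS _).2 fun f ↦ ?_
    choose g hg using fun x : X ↦ h' (f ≫ ModuleCat.ofHom (LinearMap.proj x))
    refine ⟨ModuleCat.ofHom (LinearMap.pi fun x ↦ (g x).hom), ?_⟩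
    ext k x
    exact congr(($(hg x)).hom k)
  | more k _ ih =>
    have hS := M.shortExact_projectiveShortComplex
    exact (subsingleton_ext_succ_succ_iff hS _ k).2
      (ih _ ((subsingleton_ext_succ_succ_iff hS N k).1 h))

/-- The direct sum of copies of a short complex of modules. -/
abbrev finsuppShortComplex (X : Type) (S : ShortComplex (ModuleCat.{0} A)) :
    ShortComplex (ModuleCat.{0} A) where
  X₁ := ModuleCat.of A (X →₀ S.X₁)
  X₂ := ModuleCat.of A (X →₀ S.X₂)
  X₃ := ModuleCat.of A (X →₀ S.X₃)
  f := ModuleCat.ofHom (Finsupp.mapRange.linearMap S.f.hom)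
  g := ModuleCat.ofHom (Finsupp.mapRange.linearMap S.g.hom)
  zero := by
    rw [← ModuleCat.ofHom_comp, ← Finsupp.mapRange.linearMap_comp, ← ModuleCat.hom_comp, S.zero]
    ext
    simp

lemma shortExact_finsuppShortComplex (X : Type) {S : ShortComplex (ModuleCat.{0} A)}
    (hS : S.ShortExact) : (finsuppShortComplex X S).ShortExact := by
  apply ModuleCat.shortComplex_shortExact
  · intro v
    refine ⟨fun hv ↦ ?_, ?_⟩
    · have hex := (ShortComplex.ShortExact.moduleCat_exact_iff_function_exact _).1 hS.exact
      have hx : ∀ x, ∃ u, S.f.hom u = v x := fun x ↦ (hex (v x)).1 congr(($hv : X →₀ S.X₃) x)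
      have hx0 : ∀ x, ∃ u, S.f.hom u = v x ∧ (v x = 0 → u = 0) := fun x ↦ by
        by_cases h0 : v x = 0
        · exact ⟨0, by simp [h0], fun _ ↦ rfl⟩
        · exact (hx x).imp fun u hu ↦ ⟨hu, fun h ↦ (h0 h).elim⟩
      choose u hu hu0 using hx0
      refine ⟨Finsupp.onFinset v.support u fun x hxu ↦ ?_, ?_⟩
      · exact Finsupp.mem_support_iff.2 fun h ↦ hxu (hu0 x h)
      · exact Finsupp.ext fun x ↦ hu x
    · rintro ⟨u, rfl⟩
      exact congr(($((finsuppShortComplex X S).zero)).hom u)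
  · exact Finsupp.mapRange_injective _ (map_zero _) hS.moduleCat_injective_f
  · exact Finsupp.mapRange_surjective _ (map_zero _) hS.moduleCat_surjective_g

/-- `Ext^n(-, N)` vanishes on direct sums of copies of a module on which it vanishes. -/
lemma subsingleton_ext_finsupp (X : Type) (N : ModuleCat.{0} A) (n : ℕ) (M : ModuleCat.{0} A)
    (h : Subsingleton (Ext M N n)) : Subsingleton (Ext (ModuleCat.of A (X →₀ M)) N n) := by
  have hP (M : ModuleCat.{0} A) :
      Projective (finsuppShortComplex X M.projectiveShortComplex).X₂ :=
    ModuleCat.projective_of_free (Module.Free.chooseBasis A (X →₀ M.projectiveShortComplex.X₂))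
  induction n using Nat.twoStepInduction generalizing M with
  | zero =>
    rw [subsingleton_ext_zero_iff] at h ⊢
    intro f
    refine Finsupp.lhom_ext' fun x ↦ ?_
    rw [h (f ∘ₗ Finsupp.lsingle x), LinearMap.zero_comp]
  | one =>
    have hS := M.shortExact_projectiveShortComplex
    have h' := (subsingleton_ext_one_iff hS N).1 h
    refine (subsingleton_ext_one_iff (shortExact_finsuppShortComplex X hS) _).2 fun f ↦ ?_
    choose g hg using fun x : X ↦ h' (ModuleCat.ofHom (Finsupp.lsingle x) ≫ f)
    refine ⟨ModuleCat.ofHom (Finsupp.lsum ℕ fun x ↦ (g x).hom), ModuleCat.hom_ext ?_⟩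
    refine Finsupp.lhom_ext fun x k ↦ ?_
    simpa using congr(($(hg x)).hom k)
  | more k _ ih =>
    have hS := M.shortExact_projectiveShortComplex
    exact (subsingleton_ext_succ_succ_iff (shortExact_finsuppShortComplex X hS) _ k).2
      (ih _ ((subsingleton_ext_succ_succ_iff hS N k).1 h))

lemma subsingleton_ext_of_retract {M N N' : ModuleCat.{0} A} {n : ℕ} (i : N ⟶ N') (p : N' ⟶ N)
    (hip : i ≫ p = 𝟙 N) (h : Subsingleton (Ext M N' n)) : Subsingleton (Ext M N n) := by
  refine subsingleton_of_forall_eq 0 fun x ↦ ?_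
  rw [← Ext.comp_mk₀_id x, ← hip, ← Ext.mk₀_comp_mk₀,
    ← Ext.comp_assoc_of_third_deg_zero x _ _ (add_zero n),
    Subsingleton.elim (x.comp (Ext.mk₀ i) (add_zero n)) 0, Ext.zero_comp]

end Homological

section Pigeonhole

/-- Among `n + 1` consecutive terms with values in a set with `r` elements, where `m * r ≤ n`,
some value occurs twice at distance at least `m`. -/
lemma exists_eq_of_mul_le {r m n : ℕ} (hn : m * r ≤ n) (w : ℕ → Fin r) :
    ∃ a l, m ≤ l ∧ a + l ≤ n ∧ w a = w (a + l) := by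
  obtain ⟨y, -, hy⟩ := Finset.exists_lt_card_fiber_of_mul_lt_card_of_maps_to
    (s := Finset.range (n + 1)) (t := Finset.univ) (f := w) (n := m) (by simp)
    (by simpa [mul_comm r m] using Nat.lt_succ_of_le hn)
  set s := (Finset.range (n + 1)).filter fun x ↦ w x = y with hs
  have hne : s.Nonempty := Finset.card_pos.1 (by lia)
  have hcard := Finset.card_le_card
    (fun x hx ↦ Finset.mem_Icc.2 ⟨s.min'_le x hx, s.le_max' x hx⟩ :
      s ⊆ .Icc (s.min' hne) (s.max' hne))
  have hmin := Finset.mem_filter.1 (s.min'_mem hne)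
  have hmax := Finset.mem_filter.1 (s.max'_mem hne)
  have hle := s.min'_le_max' hne
  rw [Nat.card_Icc] at hcard
  rw [Finset.mem_range] at hmax
  refine ⟨s.min' hne, s.max' hne - s.min' hne, by lia, by lia, ?_⟩
  rw [Nat.add_sub_cancel' hle, hmin.2, hmax.2]

open Abelian

universe v u w

variable {C : Type u} [Category.{v} C] [Abelian C] [HasExt.{w} C]

/-- The iterated Yoneda product of `x` with the classes `θ k`, where an endomorphism of the
middle object `V k` is inserted at every stage. -/
def insertedProd {Z : C} {V : ℕ → C} (x : Z ⟶ V 0) (θ : ∀ k, Ext (V k) (V (k + 1)) 1)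
    (e : ∀ k, V k ⟶ V k) : ∀ n, Ext Z (V n) n
  | 0 => (Ext.mk₀ x).comp (Ext.mk₀ (e 0)) (add_zero 0)
  | n + 1 => ((insertedProd x θ e n).comp (θ n) rfl).comp (Ext.mk₀ (e (n + 1))) (add_zero (n + 1))

lemma insertedProd_congr {Z : C} {V : ℕ → C} (x : Z ⟶ V 0) (θ : ∀ k, Ext (V k) (V (k + 1)) 1)
    {e e' : ∀ k, V k ⟶ V k} (n : ℕ) (h : ∀ k ≤ n, e k = e' k) :
    insertedProd x θ e n = insertedProd x θ e' n := by
  induction n with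
  | zero => simp only [insertedProd, h 0 le_rfl]
  | succ n ih =>
    simp only [insertedProd, h (n + 1) le_rfl, ih fun k hk ↦ h k (hk.trans n.le_succ)]

/-- If the identities of all `V k` decompose as finite sums, a nonzero Yoneda product stays nonzero
after inserting suitable summands. -/
lemma exists_insertedProd_comp_ne_zero {r : ℕ} {Z : C} {V : ℕ → C} (x : Z ⟶ V 0)
    (θ : ∀ k, Ext (V k) (V (k + 1)) 1) (e : ∀ k, Fin r → (V k ⟶ V k))
    (he : ∀ k, ∑ i, e k i = 𝟙 (V k)) (n : ℕ) {Y : C} {j d : ℕ} (y : Ext (V n) Y j) (hd : n + j = d)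
    (hy : (insertedProd x θ (fun k ↦ 𝟙 (V k)) n).comp y hd ≠ 0) :
    ∃ w : ℕ → Fin r, (insertedProd x θ (fun k ↦ e k (w k)) n).comp y hd ≠ 0 := by
  induction n generalizing j with
  | zero =>
    by_contra! h
    refine hy ?_
    simp only [insertedProd, ← he, Ext.mk₀_sum, Ext.comp_sum, Ext.sum_comp]
    exact Finset.sum_eq_zero fun i _ ↦ h fun _ ↦ i
  | succ n ih =>
    by_contra! h
    refine hy ?_
    have key (z : Ext Z (V n) n) (f : V (n + 1) ⟶ V (n + 1)) :
        ((z.comp (θ n) rfl).comp (Ext.mk₀ f) (add_zero (n + 1))).comp y hd =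
        z.comp ((θ n).comp ((Ext.mk₀ f).comp y (zero_add j)) rfl) (by lia) := by
      rw [Ext.comp_assoc_of_second_deg_zero, Ext.comp_assoc _ _ _ _ _ (by lia)]
    simp only [insertedProd]
    rw [← he, Ext.mk₀_sum, Ext.comp_sum, Ext.sum_comp]
    refine Finset.sum_eq_zero fun i _ ↦ ?_
    rw [key]
    by_contra hne
    obtain ⟨w, hw⟩ := ih _ _ hne
    refine hw ?_
    have := h (Function.update w (n + 1) i)
    simp only [insertedProd, Function.update_self] at this
    rw [key] at this
    rw [← this]
    congr 1
    exact insertedProd_congr x θ n fun k hk ↦ by rw [Function.update_of_ne (by lia)]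

/-- An iterated Yoneda product vanishes once the degree is large, if the middle objects decompose
into at most `r` types and all `Ext`-groups between objects of the same type vanish in degrees at
least `m`. -/
lemma insertedProd_id_eq_zero {r m n : ℕ} (hn : m * r ≤ n) {Z : C} {V : ℕ → C} (x : Z ⟶ V 0)
    (θ : ∀ k, Ext (V k) (V (k + 1)) 1) (Q : ℕ → Fin r → C) (π : ∀ k i, V k ⟶ Q k i)
    (ι : ∀ k i, Q k i ⟶ V k) (hπι : ∀ k, ∑ i, π k i ≫ ι k i = 𝟙 (V k))
    (hQ : ∀ a b i l, m ≤ l → Subsingleton (Ext (Q a i) (Q b i) l)) :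
    insertedProd x θ (fun k ↦ 𝟙 (V k)) n = 0 := by
  by_contra hne
  obtain ⟨w, hw⟩ := exists_insertedProd_comp_ne_zero x θ _ hπι n (Ext.mk₀ (𝟙 (V n))) (add_zero n)
    (by rwa [Ext.comp_mk₀_id])
  rw [Ext.comp_mk₀_id] at hw
  obtain ⟨a, l, hml, hal, hwa⟩ := exists_eq_of_mul_le hn w
  set H := insertedProd x θ fun k ↦ π k (w k) ≫ ι k (w k) with hH
  have hsucc (k : ℕ) : H (k + 1) = ((H k).comp (θ k) rfl).comp
    (Ext.mk₀ (π (k + 1) (w (k + 1)) ≫ ι (k + 1) (w (k + 1)))) (add_zero (k + 1)) := rfl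
  have hfac : ∃ g : Ext Z (Q a (w a)) a, H a = g.comp (Ext.mk₀ (ι a (w a))) (add_zero a) := by
    cases a with
    | zero => exact ⟨Ext.mk₀ (x ≫ π 0 (w 0)), by simp [hH, insertedProd]⟩
    | succ a =>
      refine ⟨((H a).comp (θ a) rfl).comp (Ext.mk₀ (π (a + 1) (w (a + 1)))) (add_zero _), ?_⟩
      rw [Ext.comp_assoc_of_third_deg_zero ((H a).comp (θ a) rfl), Ext.mk₀_comp_mk₀, hsucc]
  obtain ⟨g, hg⟩ := hfac
  have hfac' (t : ℕ) : ∃ z : Ext (Q a (w a)) (Q (a + t) (w (a + t))) t,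
      H (a + t) = (g.comp z rfl).comp (Ext.mk₀ (ι (a + t) (w (a + t)))) (add_zero (a + t)) := by
    induction t with
    | zero => exact ⟨Ext.mk₀ (𝟙 _), by simpa using hg⟩
    | succ t ih =>
      obtain ⟨z, hz⟩ := ih
      refine ⟨(z.comp ((Ext.mk₀ (ι (a + t) (w (a + t)))).comp (θ (a + t)) (zero_add 1)) rfl).comp
        (Ext.mk₀ (π (a + t + 1) (w (a + t + 1)))) (add_zero (t + 1)), ?_⟩
      rw [← Ext.comp_assoc_of_third_deg_zero g, Ext.comp_assoc_of_third_deg_zero _ _ (Ext.mk₀ _),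
        Ext.mk₀_comp_mk₀]
      refine (hsucc (a + t)).trans ?_
      rw [hz]
      congr 1
      rw [Ext.comp_assoc_of_second_deg_zero, Ext.comp_assoc _ _ _ _ _ (by lia)]
  have hzero : H (a + l) = 0 := by
    obtain ⟨z, hz⟩ := hfac' l
    have hsub : Subsingleton (Ext (Q a (w a)) (Q (a + l) (w (a + l))) l) := by
      rw [← hwa]
      exact hQ _ _ _ _ hml
    rw [hz, Subsingleton.elim z 0, Ext.comp_zero, Ext.zero_comp]
  refine hw (Nat.le_induction hzero (fun k _ ih ↦ ?_) n hal)
  rw [hsucc, ih, Ext.zero_comp, Ext.zero_comp]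

end Pigeonhole

section Radical

open Abelian

variable {A : Type} [Ring A]

lemma jSmul_eq_smul {M : Type} [AddCommGroup M] [Module A M] (N : Submodule A M) :
    jSmul A N = (jrad A).asIdeal • N := by
  refine le_antisymm (Submodule.span_le.2 ?_) (Submodule.smul_le.2 fun x hx m hm ↦
    Submodule.subset_span ⟨x, hx, m, hm, rfl⟩)
  rintro _ ⟨x, hx, m, hm, rfl⟩
  exact Submodule.smul_mem_smul hx hm

lemma smul_mem_jSmul {M : Type} [AddCommGroup M] [Module A M] {N : Submodule A M} {x : A}
    (hx : x ∈ jrad A) {v : M} (hv : v ∈ N) : x • v ∈ jSmul A N :=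
  Submodule.subset_span ⟨x, hx, v, hv, rfl⟩

lemma map_jSmul {M N : Type} [AddCommGroup M] [Module A M] [AddCommGroup N] [Module A N]
    (f : M →ₗ[A] N) (K : Submodule A M) : (jSmul A K).map f = jSmul A (K.map f) := by
  simp only [jSmul_eq_smul, Submodule.map_smul'']

lemma jSmul_jSmul_jSmul (h3 : JCubeZero A) {M : Type} [AddCommGroup M] [Module A M]
    (N : Submodule A M) : jSmul A (jSmul A (jSmul A N)) = ⊥ := by
  simp only [jSmul_eq_smul, ← Submodule.mul_smul]
  rw [eq_bot_iff, Submodule.smul_le]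
  intro x hx n _
  suffices x = 0 by simp [this]
  induction hx using Submodule.mul_induction_on' with
  | mem_mul_mem x hx yz hyz =>
    induction hyz using Submodule.mul_induction_on' with
    | mem_mul_mem y hy z hz => rw [← mul_assoc, h3 x y z hx hy hz]
    | add _ _ _ _ h h' => rw [mul_add, h, h', add_zero]
  | add _ _ _ _ h h' => rw [h, h', add_zero]

/-- A nilpotent form of Nakayama's lemma. -/
lemma subsingleton_of_jSmul_top_eq_top (h3 : JCubeZero A) {M : Type} [AddCommGroup M] [Module A M]
    (h : jSmul A (⊤ : Submodule A M) = ⊤) : Subsingleton M := by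
  rw [← Submodule.subsingleton_iff A, ← subsingleton_iff_bot_eq_top, ← jSmul_jSmul_jSmul h3 ⊤, h, h,
    h]

lemma smul_quotient_jSmul_eq_zero {M : Type} [AddCommGroup M] [Module A M] (N : Submodule A M)
    (hN : jSmul A ⊤ ≤ N) {x : A} (hx : x ∈ jrad A) (v : M ⧸ N) : x • v = 0 := by
  obtain ⟨v, rfl⟩ := N.mkQ_surjective v
  rw [← map_smul]
  exact (Submodule.Quotient.mk_eq_zero _).2 (hN (smul_mem_jSmul hx trivial))

lemma smul_eq_zero_of_isSimpleModule_s15 (h3 : JCubeZero A) {M : Type} [AddCommGroup M] [Module A M]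
    [IsSimpleModule A M] {x : A} (hx : x ∈ jrad A) (v : M) : x • v = 0 := by
  rcases eq_bot_or_eq_top (jSmul A (⊤ : Submodule A M)) with h | h
  · exact (Submodule.mem_bot A).1 (h ▸ smul_mem_jSmul hx trivial)
  · have := subsingleton_of_jSmul_top_eq_top h3 h
    exact Subsingleton.elim _ _

lemma isSemisimpleModule_of_jrad_smul (hss : SemisimpleModJ A) {M : Type} [AddCommGroup M]
    [Module A M] (h : ∀ x ∈ jrad A, ∀ v : M, x • v = 0) : IsSemisimpleModule A M := by
  have : IsSemisimpleRing (jrad A).ringCon.Quotient := hss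
  have hle : (jrad A).ringCon ≤ RingCon.ker (Ideal.Quotient.mk (jrad A).asIdeal) := by
    intro x y hxy
    exact Ideal.Quotient.eq.2 ((TwoSidedIdeal.rel_iff _ _ _).1 hxy)
  have : IsSemisimpleRing (A ⧸ (jrad A).asIdeal) := by
    refine RingHom.isSemisimpleRing_of_surjective (RingCon.lift _ _ hle) fun y ↦ ?_
    obtain ⟨a, rfl⟩ := Ideal.Quotient.mk_surjective y
    exact ⟨(jrad A).ringCon.mk' a, rfl⟩
  have hM : Module.IsTorsionBySet A M (jrad A).asIdeal := fun v x ↦ h x x.2 v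
  let := hM.module
  exact hM.isSemisimpleModule_iff.1 inferInstance

/-- `Ext` between isotypic modules of the same type vanishes where the self-extensions of the simple
module do. -/
lemma subsingleton_ext_finsupp_finsupp (hss : SemisimpleModJ A) (h3 : JCubeZero A)
    (T : ModuleCat.{0} A) (hT : IsSimpleModule A T) {l : ℕ} (h : Subsingleton (Ext T T l))
    (X Y : Type) : Subsingleton (Ext (ModuleCat.of A (X →₀ T)) (ModuleCat.of A (Y →₀ T)) l) := by
  have : IsSemisimpleModule A (Y → T) := isSemisimpleModule_of_jrad_smul hss fun x hx v ↦
    funext fun y ↦ smul_eq_zero_of_isSimpleModule_s15 h3 hx (v y)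
  obtain ⟨p, hp⟩ := IsSemisimpleModule.extension_property (Finsupp.lcoeFun : (Y →₀ T) →ₗ[A] Y → T)
    DFunLike.coe_injective LinearMap.id
  exact subsingleton_ext_of_retract (ModuleCat.ofHom Finsupp.lcoeFun) (ModuleCat.ofHom p)
    (ModuleCat.hom_ext hp) (subsingleton_ext_pi Y T l _ (subsingleton_ext_finsupp X T l T h))

/-- A semisimple module is a finite direct sum of isotypic modules if there are only finitely many
types of simple modules. -/
lemma exists_isotypic_decomposition {r : ℕ} (rep : Fin r → ModuleCat.{0} A)
    (hrepAll : ∀ S : ModuleCat.{0} A, IsSimpleModule A S → ∃ i, Nonempty (S ≃ₗ[A] rep i))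
    (V : ModuleCat.{0} A) [IsSemisimpleModule A V] :
    ∃ (X : Type) (π : ∀ i, V ⟶ ModuleCat.of A (X →₀ rep i))
      (ι : ∀ i, ModuleCat.of A (X →₀ rep i) ⟶ V), ∑ i, π i ≫ ι i = 𝟙 V := by
  classical
  obtain ⟨s, e, -, hs⟩ := IsSemisimpleModule.exists_linearEquiv_dfinsupp A V
  choose t ht using fun x : s ↦ hrepAll (ModuleCat.of A x.1) (hs x)
  have hcd (x : s) (i : Fin r) : ∃ (c : x.1 →ₗ[A] rep i) (d : rep i →ₗ[A] x.1),
      d ∘ₗ c = if t x = i then LinearMap.id else 0 := by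
    split_ifs with h
    · subst h
      obtain ⟨f⟩ := ht x
      exact ⟨f.toLinearMap, f.symm.toLinearMap, LinearMap.ext f.symm_apply_apply⟩
    · exact ⟨0, 0, rfl⟩
  choose c d hcd using hcd
  refine ⟨s, fun i ↦ ModuleCat.ofHom ((finsuppLequivDFinsupp A).symm.toLinearMap ∘ₗ
    DFinsupp.mapRange.linearMap (fun x ↦ c x i) ∘ₗ e.toLinearMap), fun i ↦ ModuleCat.ofHom
    (e.symm.toLinearMap ∘ₗ DFinsupp.mapRange.linearMap (fun x ↦ d x i) ∘ₗ
    (finsuppLequivDFinsupp A).toLinearMap), ?_⟩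
  ext v
  rw [ModuleCat.hom_sum, LinearMap.sum_apply]
  apply e.injective
  rw [map_sum]
  ext1 x
  rw [DFinsupp.finsetSum_apply]
  have (i : Fin r) : d x i (c x i (e v x)) = if t x = i then e v x else 0 := by
    have := congr($(hcd x i) (e v x))
    split_ifs at this ⊢ <;> exact this
  simp [this]

end Radical

section AssocSeq

open Abelian

variable {A : Type} [Ring A]

lemma exists_leftInverse_of_sup_eq {P : Type} [AddCommGroup P] [Module A P] {U Y K : Submodule A P}
    (hUY : U ⊓ Y = ⊥) (hK : U ⊔ Y = K) :
    ∃ q : K →ₗ[A] U, (∀ u : U, q ⟨u, hK ▸ Submodule.mem_sup_left u.2⟩ = u) ∧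
      ∀ v : K, (v : P) - q v ∈ Y := by
  have hU : U ≤ K := hK ▸ le_sup_left
  have hY : Y ≤ K := hK ▸ le_sup_right
  have hc : IsCompl (U.submoduleOf K) (Y.submoduleOf K) := by
    refine ⟨Submodule.disjoint_def.2 fun v hv hv' ↦ Subtype.ext ?_,
      codisjoint_iff.2 (eq_top_iff.2 fun v _ ↦ ?_)⟩
    · exact (Submodule.mem_bot A).1 (hUY ▸ ⟨hv, hv'⟩)
    · obtain ⟨u, hu, y, hy, h⟩ := Submodule.mem_sup.1 (hK.symm ▸ v.2 : (v : P) ∈ U ⊔ Y)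
      exact Submodule.mem_sup.2 ⟨⟨u, hU hu⟩, hu, ⟨y, hY hy⟩, hy, Subtype.ext h⟩
  refine ⟨(Submodule.submoduleOfEquivOfLe hU).toLinearMap ∘ₗ Submodule.projectionOnto _ _ hc,
    fun u ↦ ?_, fun v ↦ ?_⟩
  · have := Submodule.projectionOnto_apply_left hc ⟨⟨u, hU u.2⟩, u.2⟩
    simp only [LinearMap.comp_apply]
    erw [this]
    rfl
  · exact Submodule.sub_projection_mem hc v

lemma exists_extension_of_inf_eq_jSmul (hss : SemisimpleModJ A) {P : Type} [AddCommGroup P]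
    [Module A P] {U Y K L : Submodule A P} (hKL : K ≤ L) (hUK : U ≤ K)
    (hY : Y ≤ jSmul A L) (hU : U ⊓ jSmul A L = jSmul A U) (q : K →ₗ[A] U)
    (hq : ∀ v : K, (v : P) - q v ∈ Y) :
    ∃ h : L →ₗ[A] U ⧸ jSmul A (⊤ : Submodule A U),
      ∀ v : K, h ⟨v, hKL v.2⟩ = (jSmul A (⊤ : Submodule A U)).mkQ (q v) := by
  let W := (jSmul A L).submoduleOf L
  have hW : jSmul A ⊤ ≤ W := by
    refine Submodule.map_le_iff_le_comap.1 ?_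
    rw [map_jSmul, Submodule.map_top, Submodule.range_subtype]
  have : IsSemisimpleModule A (L ⧸ W) :=
    isSemisimpleModule_of_jrad_smul hss fun x hx v ↦ smul_quotient_jSmul_eq_zero W hW hx v
  let u : U →ₗ[A] L ⧸ W := W.mkQ ∘ₗ Submodule.inclusion (hUK.trans hKL)
  have hu : LinearMap.ker u = jSmul A ⊤ := by
    apply Submodule.map_injective_of_injective U.subtype_injective
    rw [map_jSmul, Submodule.map_top, Submodule.range_subtype, ← hU]
    ext x
    simp only [Submodule.mem_map, LinearMap.mem_ker, u, LinearMap.comp_apply, Submodule.mkQ_apply,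
      Submodule.Quotient.mk_eq_zero]
    exact ⟨fun ⟨y, hy, h⟩ ↦ h ▸ ⟨y.2, hy⟩, fun h ↦ ⟨⟨x, h.1⟩, h.2, rfl⟩⟩
  obtain ⟨g, hg⟩ := IsSemisimpleModule.extension_property
    ((jSmul A ⊤).liftQ u hu.ge) (LinearMap.ker_eq_bot.1 (Submodule.ker_liftQ_eq_bot _ _ _ hu.le))
    LinearMap.id
  refine ⟨g ∘ₗ W.mkQ, fun v ↦ ?_⟩
  have h₁ : W.mkQ ⟨v, hKL v.2⟩ = u (q v) := by
    refine (Submodule.Quotient.eq W).2 ?_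
    exact hY (hq v)
  rw [LinearMap.comp_apply, h₁]
  exact congr($hg (Submodule.Quotient.mk (q v)))

/-- The map from a module to its largest quotient killed by the Jacobson radical. -/
abbrev topMap (M : ModuleCat.{0} A) :
    M ⟶ ModuleCat.of A (M ⧸ jSmul A (⊤ : Submodule A M)) :=
  ModuleCat.ofHom (jSmul A (⊤ : Submodule A M)).mkQ

/-- An extension of `M` by a summand `U` of its syzygy descends to the tops if
`U ∩ J²P = JU` and `U` has a complement contained in `J²P`; the Yoneda product with the class of
this extension is injective. -/
lemma exists_ext_comp_topMap_eq (hss : SemisimpleModJ A) (M P N : ModuleCat.{0} A)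
    [Projective P] (π : P →ₗ[A] M) (hπ : Function.Surjective π)
    (hker : LinearMap.ker π ≤ jSmul A ⊤) (U Y : Submodule A P) (hUY : U ⊓ Y = ⊥)
    (hsup : U ⊔ Y = LinearMap.ker π) (hY : Y ≤ jSmul A (jSmul A ⊤))
    (hU : U ⊓ jSmul A (jSmul A ⊤) = jSmul A U) (e : N ≃ₗ[A] U) :
    ∃ (ε : Ext M N 1) (θ : Ext (ModuleCat.of A (M ⧸ jSmul A (⊤ : Submodule A M)))
        (ModuleCat.of A (N ⧸ jSmul A (⊤ : Submodule A N))) 1),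
      ε.comp (Ext.mk₀ (topMap N)) (add_zero 1) =
        (Ext.mk₀ (topMap M)).comp θ (zero_add 1) ∧
      (∀ (X : ModuleCat.{0} A) (i j : ℕ) (y : Ext N X (i + 1))
        (hj : 1 + (i + 1) = j),
        ε.comp y hj = 0 → y = 0) ∧
      ∀ (X : ModuleCat.{0} A), (∀ x ∈ jrad A, ∀ v : X, x • v = 0) →
        ∀ f : N ⟶ X, ε.comp (Ext.mk₀ f) (add_zero 1) = 0 → f = 0 := by
  obtain ⟨q, hq, hqY⟩ := exists_leftInverse_of_sup_eq hUY hsup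
  have hUK : U ≤ LinearMap.ker π := hsup ▸ le_sup_left
  have hS := LinearMap.shortExact_shortComplexKer hπ
  let q' := e.symm.toLinearMap ∘ₗ q
  have hret : ModuleCat.ofHom (Submodule.inclusion hUK ∘ₗ e.toLinearMap) ≫ ModuleCat.ofHom q' =
      𝟙 N := by
    ext u
    exact (congrArg e.symm (hq (e u))).trans (e.symm_apply_apply u)
  let t := (jSmul A (⊤ : Submodule A M)).mkQ ∘ₗ π
  have ht : Function.Surjective t := (Submodule.mkQ_surjective _).comp hπ
  have hkt : LinearMap.ker t = jSmul A ⊤ := by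
    rw [LinearMap.ker_comp, Submodule.ker_mkQ, ← LinearMap.range_eq_top.2 hπ, ← Submodule.map_top,
      ← map_jSmul, Submodule.comap_map_eq, sup_eq_left.2 hker]
  rw [← hkt] at hker hY hU
  obtain ⟨h, hh⟩ := exists_extension_of_inf_eq_jSmul hss hker hUK hY hU q hqY
  have he : jSmul A (⊤ : Submodule A U) ≤ (jSmul A ⊤).comap e.symm.toLinearMap := by
    refine Submodule.map_le_iff_le_comap.1 ?_
    rw [map_jSmul, Submodule.map_top, LinearEquiv.range]
  let h' := (jSmul A ⊤).mapQ (jSmul A ⊤) e.symm.toLinearMap he ∘ₗ h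
  have hS' := LinearMap.shortExact_shortComplexKer ht
  refine ⟨hS.extClass.comp (Ext.mk₀ (ModuleCat.ofHom q')) (add_zero 1),
    hS'.extClass.comp (Ext.mk₀ (ModuleCat.ofHom h')) (add_zero 1), ?_, ?_, ?_⟩
  · let F : π.shortComplexKer ⟶ t.shortComplexKer :=
      { τ₁ := ModuleCat.ofHom (Submodule.inclusion hker)
        τ₂ := 𝟙 P
        τ₃ := topMap M }
    have hF := ShortComplex.ShortExact.extClass_naturality hS hS' F
    have hFh : ModuleCat.ofHom q' ≫ topMap N = F.τ₁ ≫ ModuleCat.ofHom h' := by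
      ext v
      exact congrArg ((jSmul A ⊤).mapQ (jSmul A ⊤) e.symm.toLinearMap he) (hh v).symm
    rw [Ext.comp_assoc_of_third_deg_zero, Ext.mk₀_comp_mk₀, hFh, ← Ext.mk₀_comp_mk₀,
      ← Ext.comp_assoc_of_third_deg_zero, hF, Ext.comp_assoc_of_third_deg_zero]
  · intro X i j y hj hy
    rw [Ext.comp_assoc_of_second_deg_zero] at hy
    obtain ⟨z, hz⟩ := Ext.contravariant_sequence_exact₁ hS X _ hj hy
    have : Projective π.shortComplexKer.X₂ := ‹Projective P›
    rw [Ext.eq_zero_of_projective z, Ext.comp_zero] at hz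
    rw [← Ext.mk₀_id_comp y, ← hret, ← Ext.mk₀_comp_mk₀,
      Ext.comp_assoc _ _ _ (zero_add 0) (zero_add _) (by lia), ← hz, Ext.comp_zero]
  · intro X hX f hf
    rw [Ext.comp_assoc_of_third_deg_zero, Ext.mk₀_comp_mk₀] at hf
    obtain ⟨z, hz⟩ := Ext.contravariant_sequence_exact₁ hS X _ (add_zero 1) hf
    obtain ⟨g, rfl⟩ := (Ext.mk₀_bijective _ _).2 z
    rw [Ext.mk₀_comp_mk₀] at hz
    have hz := (Ext.mk₀_bijective _ _).1 hz
    suffices π.shortComplexKer.f ≫ g = 0 by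
      rw [← Category.id_comp f, ← hret, Category.assoc, ← hz, this, Limits.comp_zero]
    ext v
    have hv : (v : P) ∈ jSmul A ⊤ := hkt ▸ hker v.2
    have hle : jSmul A ⊤ ≤ LinearMap.ker g.hom := by
      refine Submodule.span_le.2 ?_
      rintro _ ⟨x, hx, w, -, rfl⟩
      exact (map_smul g.hom x w).trans (hX x hx _)
    exact hle hv

end AssocSeq

/-- If `A/J` is semisimple, `J³ = 0`, there are `r` isomorphism classes of simple
modules and `Ext^k(T, T) = 0` for all simple `T` and `k ≥ m`, then for every
simple `S` the associated sequence `(Mₙ)` satisfies `Mₙ = 0` for all `n > m·r`. -/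
theorem stmt_15 (A : Type) [Ring A] (hss : SemisimpleModJ A) (h3 : JCubeZero A)
    (r m : ℕ) (rep : Fin r → ModuleCat.{0} A)
    (hrep : ∀ i, IsSimpleModule A (rep i))
    (hrepAll : ∀ S : ModuleCat.{0} A, IsSimpleModule A S →
      ∃ i, Nonempty (S ≃ₗ[A] rep i))
    (hrepNe : ∀ i j, i ≠ j → IsEmpty (rep i ≃ₗ[A] rep j))
    (hvan : ExtSelfVanishes A m)
    (S : ModuleCat.{0} A) (hS : IsSimpleModule A S) (d : AssocSeqData A S) :
    ∀ n : ℕ, m * r < n → Subsingleton (d.M n) := by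
  intro n hn
  have hproj (k : ℕ) : Projective (d.P k) := by
    have := d.proj k
    exact (IsProjective.iff_projective (d.P k)).1 this
  choose ε θ hεθ hinj hinj₀ using fun k ↦ exists_ext_comp_topMap_eq hss (d.M k) (d.P k)
    (d.M (k + 1)) (d.π k) (d.surj k) (d.cover k) (d.Msub k) (d.Ysub k) (d.indep k) (d.sup_eq k)
    (d.Y_summand k).1 (d.M_cap k) (d.isoM k).some
  have hinj' (k i j : ℕ) (X : ModuleCat.{0} A) (y : Abelian.Ext (d.M k) X (i + 1))
      (hj : k + (i + 1) = j)
      (hy : (extChain A d.M ε k).comp y hj = 0) : y = 0 := by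
    induction k generalizing i j with
    | zero =>
      obtain rfl : i + 1 = j := by lia
      rwa [extChain, Abelian.Ext.mk₀_id_comp] at hy
    | succ k ih =>
      rw [extChain, Abelian.Ext.comp_assoc _ _ _ rfl rfl (by lia)] at hy
      exact hinj k X i (1 + i + 1) y (by lia) (ih (1 + i) j _ (by lia) hy)
  have hprod (k : ℕ) : insertedProd (topMap (d.M 0)) θ (fun k ↦ 𝟙 _) k =
      (extChain A d.M ε k).comp (Abelian.Ext.mk₀ (topMap (d.M k))) (add_zero k) := by
    induction k with
    | zero => rw [insertedProd, extChain, Abelian.Ext.mk₀_id_comp, Abelian.Ext.comp_mk₀_id]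
    | succ k ih =>
      rw [insertedProd, Abelian.Ext.comp_mk₀_id, ih, extChain,
        Abelian.Ext.comp_assoc_of_second_deg_zero, ← hεθ, Abelian.Ext.comp_assoc_of_third_deg_zero]
  have hss' (k : ℕ) : IsSemisimpleModule A (d.M k ⧸ jSmul A (⊤ : Submodule A (d.M k))) :=
    isSemisimpleModule_of_jrad_smul hss fun x hx v ↦
      smul_quotient_jSmul_eq_zero _ le_rfl hx v
  choose X π ι hπι using fun k ↦ exists_isotypic_decomposition rep hrepAll
    (ModuleCat.of A (d.M k ⧸ jSmul A (⊤ : Submodule A (d.M k))))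
  have hzero := hprod n
  rw [insertedProd_id_eq_zero hn.le _ θ (fun k i ↦ ModuleCat.of A (X k →₀ rep i)) π ι hπι
    fun a b i l hl ↦ subsingleton_ext_finsupp_finsupp hss h3 (rep i) (hrep i)
      (hvan (rep i) (hrep i) l hl) (X a) (X b)] at hzero
  suffices topMap (d.M n) = 0 by
    refine subsingleton_of_jSmul_top_eq_top h3 ?_
    rw [← Submodule.ker_mkQ (jSmul A ⊤), LinearMap.ker_eq_top]
    exact congrArg ModuleCat.Hom.hom this
  obtain _ | n := n
  · lia
  · rw [extChain, Abelian.Ext.comp_assoc_of_third_deg_zero] at hzero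
    exact hinj₀ n _ (fun x hx v ↦ smul_quotient_jSmul_eq_zero _ le_rfl hx v) _
      (hinj' n 0 _ _ _ rfl hzero.symm)

end
end
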